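/- Let 0 < γ < 1 + α/2. Then problem (P_∞) has no solution. -/

import Mathlib

open MeasureTheory Real Filter Topology Metric Set

noncomputable section

abbrev EN (N : ℕ) := EuclideanSpace ℝ (Fin N)

/-- The normalizing constant `c_{N,α}` of the fractional Laplacian. -/
def fracLapCoeff (N : ℕ) (α : ℝ) : ℝ :=
  2 ^ α * Real.pi ^ (-(N : ℝ) / 2) * Real.Gamma (((N : ℝ) + α) / 2) / |Real.Gamma (-α / 2)|

/-- `HasFracLap N α u x L` means the principal-value limit defining `Δ^{α/2} u (x)` exists
and equals `L`. -/
def HasFracLap (N : ℕ) (α : ℝ) (u : EN N → ℝ) (x : EN N) (L : ℝ) : Prop :=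
  Tendsto (fun ε : ℝ =>
      fracLapCoeff N α * ∫ y in {y : EN N | ε < dist y x}, (u y - u x) / dist y x ^ ((N : ℝ) + α))
    (𝓝[>] (0 : ℝ)) (𝓝 L)

/-- The value of the fractional Laplacian at `x` (junk value `0` where the limit fails). -/
def fracLap (N : ℕ) (α : ℝ) (u : EN N → ℝ) (x : EN N) : ℝ :=
  haveI := Classical.propDecidable (∃ L, HasFracLap N α u x L)
  if h : ∃ L, HasFracLap N α u x L then h.choose else 0

/-- The weighted space `𝓛_α`. -/
def memLalpha (N : ℕ) (α : ℝ) (u : EN N → ℝ) : Prop :=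
  Integrable (fun y : EN N => u y * (1 + ‖y‖) ^ (-((N : ℝ) + α)))

/-- `δ(x) = 1 - |x|` on the unit ball, `0` outside. -/
def delta1 {N : ℕ} (x : EN N) : ℝ := if ‖x‖ < 1 then 1 - ‖x‖ else 0

/-- The constant `κ_{N,α}`. -/
def greenCoeff (N : ℕ) (α : ℝ) : ℝ :=
  Real.Gamma ((N : ℝ) / 2) / (2 ^ α * Real.pi ^ ((N : ℝ) / 2) * Real.Gamma (α / 2) ^ 2)

/-- The Green function of the unit ball. -/
def greenB (N : ℕ) (α : ℝ) (x y : EN N) : ℝ :=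
  if ‖x‖ < 1 ∧ ‖y‖ < 1 then
    greenCoeff N α * ‖x - y‖ ^ (α - (N : ℝ)) *
      ∫ s in (0:ℝ)..((1 - ‖x‖ ^ 2) * (1 - ‖y‖ ^ 2) / ‖x - y‖ ^ 2),
        s ^ (α / 2 - 1) * (1 + s) ^ (-(N : ℝ) / 2)
  else 0

/-- The Green function of the ball `B(a,r)`, by scaling. -/
def greenBall (N : ℕ) (α : ℝ) (a : EN N) (r : ℝ) (x y : EN N) : ℝ :=
  r ^ (α - (N : ℝ)) * greenB N α (r⁻¹ • (x - a)) (r⁻¹ • (y - a))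

/-- The constant `c_α^N` of the Poisson kernel. -/
def poissonCoeff (N : ℕ) (α : ℝ) : ℝ :=
  Real.pi ^ (-1 - (N : ℝ) / 2) * Real.Gamma ((N : ℝ) / 2) * Real.sin (Real.pi * α / 2)

/-- The Poisson kernel of the ball `B(a,r)`. -/
def poissonBall (N : ℕ) (α : ℝ) (a : EN N) (r : ℝ) (x y : EN N) : ℝ :=
  poissonCoeff N α * ((r ^ 2 - ‖x - a‖ ^ 2) / (‖y - a‖ ^ 2 - r ^ 2)) ^ (α / 2) *
    ‖x - y‖ ^ (-(N : ℝ))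

/-- The harmonic-measure operator `H^α_{B(a,r)} f`. -/
def Hball (N : ℕ) (α : ℝ) (a : EN N) (r : ℝ) (f : EN N → ℝ) (x : EN N) : ℝ :=
  ∫ y in {y : EN N | r < ‖y - a‖}, poissonBall N α a r x y * f y

/-- Solution (in the distributional sense) of `Δ^{α/2} u = u^γ` in the open set `U`. -/
def IsSolution (N : ℕ) (α γ : ℝ) (U : Set (EN N)) (u : EN N → ℝ) : Prop :=
  (∀ x, 0 ≤ u x) ∧ ContinuousOn u U ∧ memLalpha N α u ∧
    ∀ φ : EN N → ℝ, ContDiff ℝ (⊤ : ℕ∞) φ → HasCompactSupport φ → tsupport φ ⊆ U →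
      (∀ x, 0 ≤ φ x) →
        ∫ x, u x * fracLap N α φ x = ∫ x, u x ^ γ * φ x

/-- The surface measure `σ` on the unit sphere. -/
def sphereMeasure (N : ℕ) : Measure (Metric.sphere (0 : EN N) 1) :=
  (volume : Measure (EN N)).toSphere

/-- The Martin integral `M_B^α g`. -/
def martinB (N : ℕ) (α : ℝ) (g : Metric.sphere (0 : EN N) 1 → ℝ) (x : EN N) : ℝ :=
  if ‖x‖ < 1 then
    ∫ y, (1 - ‖x‖ ^ 2) ^ (α / 2) * ‖x - (y : EN N)‖ ^ (-(N : ℝ)) * g y ∂(sphereMeasure N)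
  else 0

/-- Solution of the moderate blow-up problem `(P_g)`. -/
def IsSolutionPg (N : ℕ) (α γ : ℝ) (g : Metric.sphere (0 : EN N) 1 → ℝ) (u : EN N → ℝ) : Prop :=
  (∀ x, 0 ≤ u x) ∧ memLalpha N α u ∧ (∀ x : EN N, ¬ ‖x‖ < 1 → u x = 0) ∧
    IsSolution N α γ (Metric.ball (0 : EN N) 1) u ∧
    ∀ z : Metric.sphere (0 : EN N) 1,
      Tendsto (fun x => delta1 x ^ (1 - α / 2) * u x)
        (𝓝[Metric.ball (0 : EN N) 1] (z : EN N)) (𝓝 (g z))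

/-- Solution of the blow-up problem `(P_∞)`. -/
def IsSolutionPinf (N : ℕ) (α γ : ℝ) (u : EN N → ℝ) : Prop :=
  (∀ x, 0 ≤ u x) ∧ memLalpha N α u ∧ (∀ x : EN N, ¬ ‖x‖ < 1 → u x = 0) ∧
    IsSolution N α γ (Metric.ball (0 : EN N) 1) u ∧
    ∀ z : Metric.sphere (0 : EN N) 1,
      Tendsto (fun x => delta1 x ^ (1 - α / 2) * u x)
        (𝓝[Metric.ball (0 : EN N) 1] (z : EN N)) atTop


lemma od_int {α a b ρ : ℝ} (c : ℝ) (hα0 : 0 < α) (hb : 0 < b) (hρ : 0 < ρ) (hρa : ρ ≤ a) :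
    IntervalIntegrable (fun s => ((a - s) * (b + s)) ^ (α / 2 - 1) * s ^ c) volume ρ a := by
  have h1 : IntervalIntegrable (fun s : ℝ => (a - s) ^ (α / 2 - 1)) volume ρ a := by
    have := (intervalIntegral.intervalIntegrable_rpow' (a := a - ρ) (b := 0)
      (r := α / 2 - 1) (by linarith)).comp_sub_left a
    simpa using this
  have h2 : ContinuousOn (fun s : ℝ => (b + s) ^ (α / 2 - 1) * s ^ c) (uIcc ρ a) := by
    rw [uIcc_of_le hρa]
    apply ContinuousOn.mul
    · apply ContinuousOn.rpow_const (by fun_prop)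
      intro x hx; left; have := hx.1; linarith
    · apply ContinuousOn.rpow_const (by fun_prop)
      intro x hx; left; have := hx.1; linarith
  have h3 := h1.mul_continuousOn h2
  refine h3.congr ?_
  intro s hs
  rw [uIoc_of_le hρa] at hs
  have := hs.1; have := hs.2
  simp only
  rw [Real.mul_rpow (by linarith) (by linarith)]
  ring

lemma od_ftc {α a b ρ : ℝ} (hα0 : 0 < α) (ha : 0 < a) (hb : 0 < b) (hρ : 0 < ρ) (hρa : ρ ≤ a) :
    (∫ s in ρ..a, ((a - s) * (b + s)) ^ (α / 2 - 1) * s ^ (-1 - α)) =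
      ((a - ρ) * (b + ρ)) ^ (α / 2) * ρ ^ (-α) / (α * (a * b))
      - (a - b) / (2 * (a * b)) *
        ∫ s in ρ..a, ((a - s) * (b + s)) ^ (α / 2 - 1) * s ^ (-α) := by
  have hi1 := od_int (α := α) (-1 - α) hα0 hb hρ hρa
  have hi2 := od_int (α := α) (-α) hα0 hb hρ hρa
  have key : (∫ s in ρ..a, (((a - s) * (b + s)) ^ (α / 2 - 1) * s ^ (-1 - α)
      + (a - b) / (2 * (a * b)) * (((a - s) * (b + s)) ^ (α / 2 - 1) * s ^ (-α)))) =
      (fun s : ℝ => - (((a - s) * (b + s)) ^ (α / 2) * s ^ (-α) / (α * (a * b)))) a -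
      (fun s : ℝ => - (((a - s) * (b + s)) ^ (α / 2) * s ^ (-α) / (α * (a * b)))) ρ := by
    refine intervalIntegral.integral_eq_sub_of_hasDerivAt_of_le (f := fun s : ℝ => - (((a - s) * (b + s)) ^ (α / 2) * s ^ (-α) / (α * (a * b)))) hρa ?_ ?_ ?_
    · apply ContinuousOn.neg
      apply ContinuousOn.div_const
      apply ContinuousOn.mul
      · apply ContinuousOn.rpow_const (by fun_prop)
        intro x hx; right; linarith
      · apply ContinuousOn.rpow_const (by fun_prop)
        intro x hx; left; have := hx.1; linarith
    · intro s hs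
      have hs1 := hs.1
      have hs2 := hs.2
      have hs0 : 0 < s := by linarith
      have hQ : 0 < (a - s) * (b + s) := mul_pos (by linarith) (by linarith)
      have d1 : HasDerivAt (fun s : ℝ => (a - s) * (b + s)) (a - b - 2 * s) s := by
        have := ((hasDerivAt_id s).const_sub a).mul ((hasDerivAt_id s).const_add b)
        refine this.congr_deriv ?_
        simp only [id]
        ring
      have d2 := d1.rpow_const (p := α / 2) (Or.inl hQ.ne')
      have d3 : HasDerivAt (fun s : ℝ => s ^ (-α)) _ s := Real.hasDerivAt_rpow_const (p := -α) (Or.inl hs0.ne')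
      have d4 := ((d2.mul d3).div_const (α * (a * b))).neg
      refine d4.congr_deriv ?_
      have e1 : ((a - s) * (b + s)) ^ (α / 2) = ((a - s) * (b + s)) ^ (α / 2 - 1) * ((a - s) * (b + s)) := by
        rw [← Real.rpow_add_one hQ.ne']; congr 1; ring
      have e2 : s ^ (-α) = s ^ (-1 - α) * s := by
        rw [← Real.rpow_add_one hs0.ne']; congr 1; ring
      have e3 : (-α - 1 : ℝ) = -1 - α := by ring
      rw [e1, e2, e3]
      field_simp
      ring
    · exact hi1.add (hi2.const_mul _)
  rw [intervalIntegral.integral_add hi1 (hi2.const_mul _), intervalIntegral.integral_const_mul] at key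
  have z : ((a - a) * (b + a)) ^ (α / 2) = 0 := by
    rw [sub_self, zero_mul, Real.zero_rpow (by linarith)]
  simp only [z, zero_mul, zero_div] at key
  linarith

/-- change of variable `1/s = 1/r + 1/b - 1/a`. -/
lemma od_cov {α a b ρ ρ' : ℝ} (ha : 0 < a) (hb : 0 < b)
    (hρ' : 0 < ρ') (hρ'a : ρ' ≤ a) (hrr : ρ = ρ' / (1 + (1 / b - 1 / a) * ρ')) (hρb : ρ ≤ b) :
    (∫ s in ρ..b, ((b - s) * (a + s)) ^ (α / 2 - 1) * s ^ (-α)) =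
      ∫ s in ρ'..a, ((a - s) * (b + s)) ^ (α / 2 - 1) * s ^ (-α) := by
  set l := 1 / b - 1 / a with hl
  have hpos : ∀ r, 0 < r → r ≤ a → 0 < 1 + l * r := by
    intro r hr hra
    have h1 : (1 / a) * r ≤ 1 := by
      rw [one_div, inv_mul_le_iff₀ ha]; linarith
    have h2 : 0 < (1 / b) * r := by positivity
    rw [hl]; nlinarith
  have himg : (fun r => r / (1 + l * r)) '' (Ioo ρ' a) = Ioo ρ b := by
    have hmono : ∀ r1 r2, 0 < r1 → r2 ≤ a → r1 < r2 → r1 / (1 + l * r1) < r2 / (1 + l * r2) := by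
      intro r1 r2 h1 h2 h12
      rw [div_lt_div_iff₀ (hpos r1 h1 (by linarith)) (hpos r2 (by linarith) h2)]
      nlinarith
    have hga : a / (1 + l * a) = b := by
      rw [div_eq_iff (hpos a ha le_rfl).ne', hl]; field_simp; ring
    ext s
    constructor
    · rintro ⟨r, ⟨h1, h2⟩, rfl⟩
      refine ⟨?_, ?_⟩
      · rw [hrr]; exact hmono _ _ hρ' h2.le h1
      · simp only; rw [← hga]; exact hmono _ _ (hρ'.trans h1) le_rfl h2
    · rintro ⟨h1, h2⟩
      have hc : ContinuousOn (fun r => r / (1 + l * r)) (Icc ρ' a) := by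
        apply ContinuousOn.div (by fun_prop) (by fun_prop)
        intro x hx; exact (hpos x (hρ'.trans_le hx.1) hx.2).ne'
      have := intermediate_value_Ioo hρ'a hc
      apply this
      rw [hga, ← hrr]
      exact ⟨h1, h2⟩
  rw [intervalIntegral.integral_of_le hρb, intervalIntegral.integral_of_le hρ'a,
    integral_Ioc_eq_integral_Ioo, integral_Ioc_eq_integral_Ioo, ← himg,
    integral_image_eq_integral_abs_deriv_smul (f' := fun r => 1 / (1 + l * r) ^ 2) measurableSet_Ioo]
  · apply setIntegral_congr_fun measurableSet_Ioo
    intro r hr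
    have hr0 : 0 < r := hρ'.trans hr.1
    have hp := hpos r hr0 hr.2.le
    simp only [smul_eq_mul]
    have hs : 0 < r / (1 + l * r) := by positivity
    have eQ : (b - r / (1 + l * r)) * (a + r / (1 + l * r)) =
        ((a - r) * (b + r)) * ((1 + l * r) ^ 2)⁻¹ := by
      have e : l * (a * b) = a - b := by rw [hl]; field_simp
      have E1 : a * (1 + l * r) + r = (a * (b + r)) / b := by
        field_simp
        linear_combination r * e
      have E2 : b * (1 + l * r) - r = b * (a - r) / a := by
        field_simp
        linear_combination r * e
      have E3 : b - r / (1 + l * r) = (b * (1 + l * r) - r) / (1 + l * r) := by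
        rw [sub_div, mul_div_cancel_right₀ _ hp.ne']
      have E4 : a + r / (1 + l * r) = (a * (1 + l * r) + r) / (1 + l * r) := by
        rw [add_div, mul_div_cancel_right₀ _ hp.ne']
      rw [E3, E4, E1, E2]
      generalize 1 + l * r = p at *
      field_simp
    have hQ : 0 < (a - r) * (b + r) := mul_pos (by linarith [hr.2]) (by linarith)
    rw [eQ, Real.mul_rpow hQ.le (by positivity), abs_of_pos (by positivity),
      Real.div_rpow hr0.le hp.le]
    have e4 : (((1 + l * r) ^ 2)⁻¹ : ℝ) ^ (α / 2 - 1) = (1 + l * r) ^ (2 - α) := by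
      rw [← Real.rpow_natCast, ← Real.rpow_neg hp.le, ← Real.rpow_mul hp.le]
      congr 1; push_cast; ring
    have e5 : (1 + l * r) ^ (2 - α) = (1 + l * r) ^ 2 * (1 + l * r) ^ (-α) := by
      rw [← Real.rpow_natCast, ← Real.rpow_add hp]
      congr 1
    rw [e4, e5]
    have : 0 < (1 + l * r) ^ (-α) := Real.rpow_pos_of_pos hp _
    field_simp
  · intro r hr
    have hr0 : 0 < r := hρ'.trans hr.1
    have hp := hpos r hr0 hr.2.le
    have := (hasDerivAt_id r).div (((hasDerivAt_id r).const_mul l).const_add 1) hp.ne'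
    refine (this.congr_deriv ?_).hasDerivWithinAt
    simp
    ring
  · intro r1 h1 r2 h2 h
    have p1 := hpos r1 (hρ'.trans h1.1) h1.2.le
    have p2 := hpos r2 (hρ'.trans h2.1) h2.2.le
    simp only at h
    rw [div_eq_div_iff p1.ne' p2.ne'] at h
    linarith

lemma od_amgm {α δ₀ a b ρ : ℝ} (hα0 : 0 < α) (hα2 : α < 2) (hδ : 0 < δ₀)
    (ha : δ₀ ≤ a) (hb : δ₀ ≤ b) (hρ : 0 < ρ) (hρδ : ρ ≤ δ₀ / 4) :
    2 * (a * b) ^ (α / 2) * (1 - ρ ^ 2 * (2 / δ₀ ^ 2)) ≤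
      ((a - ρ) * (b + ρ)) ^ (α / 2) + ((b - ρ) * (a + ρ)) ^ (α / 2) := by
    have ha0 : 0 < a := by linarith
    have hb0 : 0 < b := by linarith
    have hX : 0 < (a - ρ) * (b + ρ) := mul_pos (by linarith) (by linarith)
    have hY : 0 < (b - ρ) * (a + ρ) := mul_pos (by linarith) (by linarith)
    generalize hXd : (a - ρ) * (b + ρ) = X at *
    generalize hYd : (b - ρ) * (a + ρ) = Y at *
    have h1 : 2 * (X ^ (α / 4) * Y ^ (α / 4)) ≤ X ^ (α / 2) + Y ^ (α / 2) := by
      have ex : X ^ (α / 2) = (X ^ (α / 4)) ^ 2 := by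
        rw [← Real.rpow_natCast, ← Real.rpow_mul hX.le]; congr 1; push_cast; ring
      have ey : Y ^ (α / 2) = (Y ^ (α / 4)) ^ 2 := by
        rw [← Real.rpow_natCast, ← Real.rpow_mul hY.le]; congr 1; push_cast; ring
      rw [ex, ey]
      nlinarith [sq_nonneg (X ^ (α / 4) - Y ^ (α / 4))]
    have hXY : X * Y = (a * b) ^ 2 * ((1 - ρ ^ 2 / a ^ 2) * (1 - ρ ^ 2 / b ^ 2)) := by
      rw [← hXd, ← hYd]; field_simp; ring
    have h2 : X ^ (α / 4) * Y ^ (α / 4) =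
        (a * b) ^ (α / 2) * ((1 - ρ ^ 2 / a ^ 2) * (1 - ρ ^ 2 / b ^ 2)) ^ (α / 4) := by
      have hpa : 0 ≤ 1 - ρ ^ 2 / a ^ 2 := by
        rw [sub_nonneg, div_le_one (by positivity)]; exact pow_le_pow_left₀ hρ.le (by linarith) 2
      have hpb : 0 ≤ 1 - ρ ^ 2 / b ^ 2 := by
        rw [sub_nonneg, div_le_one (by positivity)]; exact pow_le_pow_left₀ hρ.le (by linarith) 2
      rw [← Real.mul_rpow hX.le hY.le, hXY, Real.mul_rpow (by positivity) (mul_nonneg hpa hpb)]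
      congr 1
      rw [← Real.rpow_natCast, ← Real.rpow_mul (by positivity)]; congr 1; push_cast; ring
    have hA : ρ ^ 2 / a ^ 2 ≤ ρ ^ 2 / δ₀ ^ 2 := by gcongr
    have hB : ρ ^ 2 / b ^ 2 ≤ ρ ^ 2 / δ₀ ^ 2 := by gcongr
    have hD : ρ ^ 2 / δ₀ ^ 2 ≤ 1 := by
      rw [div_le_one (by positivity)]; exact pow_le_pow_left₀ hρ.le (by linarith) 2
    have hA0 : 0 ≤ ρ ^ 2 / a ^ 2 := by positivity
    have hB0 : 0 ≤ ρ ^ 2 / b ^ 2 := by positivity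
    have h3 : (1 - ρ ^ 2 / a ^ 2) * (1 - ρ ^ 2 / b ^ 2) ≤
        ((1 - ρ ^ 2 / a ^ 2) * (1 - ρ ^ 2 / b ^ 2)) ^ (α / 4) := by
      apply Real.self_le_rpow_of_le_one
      · exact mul_nonneg (by linarith) (by linarith)
      · exact mul_le_one₀ (by linarith) (by linarith) (by linarith)
      · linarith
    have h4 : 1 - ρ ^ 2 * (2 / δ₀ ^ 2) ≤ (1 - ρ ^ 2 / a ^ 2) * (1 - ρ ^ 2 / b ^ 2) := by
      have : ρ ^ 2 * (2 / δ₀ ^ 2) = 2 * (ρ ^ 2 / δ₀ ^ 2) := by ring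
      nlinarith [mul_nonneg hA0 hB0]
    calc 2 * (a * b) ^ (α / 2) * (1 - ρ ^ 2 * (2 / δ₀ ^ 2))
        ≤ 2 * (a * b) ^ (α / 2) * ((1 - ρ ^ 2 / a ^ 2) * (1 - ρ ^ 2 / b ^ 2)) ^ (α / 4) := by
          gcongr; exact h4.trans h3
      _ = 2 * (X ^ (α / 4) * Y ^ (α / 4)) := by rw [h2]; ring
      _ ≤ _ := h1

lemma od_main_aux {α δ₀ a b ρ : ℝ} (hα0 : 0 < α) (hα2 : α < 2) (hδ : 0 < δ₀) (hδ1 : δ₀ ≤ 1)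
    (ha : δ₀ ≤ a) (ha2 : a ≤ 2) (hb : δ₀ ≤ b) (hb2 : b ≤ 2) (hab : b ≤ a)
    (hρ : 0 < ρ) (hρ0 : ρ ≤ δ₀ ^ 2 / 4) :
    2 * (a * b) ^ (α / 2 - 1) * ρ ^ (-α) / α
      - ((2 / α) * (δ₀ ^ 2) ^ (α / 2 - 1) * (2 / δ₀ ^ 2)
        + 4 * (1 / δ₀ ^ 2) ^ 2 * (δ₀ ^ 2 / 2) ^ (α / 2 - 1)) * ρ ^ (2 - α) ≤
    (∫ s in ρ..a, ((a - s) * (b + s)) ^ (α / 2 - 1) * s ^ (-1 - α)) +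
      ∫ s in ρ..b, ((b - s) * (a + s)) ^ (α / 2 - 1) * s ^ (-1 - α) := by
  have ha0 : 0 < a := by linarith
  have hb0 : 0 < b := by linarith
  have hρδ : ρ ≤ δ₀ / 4 := by nlinarith
  have hδab : δ₀ ^ 2 ≤ a * b := by nlinarith
  set e := (a - b) / (2 * (a * b)) with he
  have he0 : 0 ≤ e := div_nonneg (by linarith) (by positivity)
  have heE : e ≤ 1 / δ₀ ^ 2 := by
    rw [he, div_le_div_iff₀ (by positivity) (by positivity)]
    nlinarith
  have heρ : 2 * e * ρ ≤ 1 / 2 := by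
    have : e * ρ ≤ (1 / δ₀ ^ 2) * (δ₀ ^ 2 / 4) := by gcongr
    have h2 : (1 / δ₀ ^ 2) * (δ₀ ^ 2 / 4) = 1 / 4 := by field_simp
    linarith
  have hl : 1 / b - 1 / a = 2 * e := by rw [he]; field_simp
  set ρ' := ρ / (1 - 2 * e * ρ) with hρ'
  have hden : 0 < 1 - 2 * e * ρ := by linarith
  have hρ'0 : 0 < ρ' := by positivity
  have hrr' : ρ ≤ ρ' := by
    rw [hρ', le_div_iff₀ hden]; nlinarith [mul_nonneg he0 hρ.le]
  have hr2 : ρ' ≤ 2 * ρ := by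
    rw [hρ', div_le_iff₀ hden]; nlinarith
  have hdiff : ρ' - ρ ≤ 4 * (1 / δ₀ ^ 2) * ρ ^ 2 := by
    have : ρ' - ρ = 2 * e * ρ * ρ' := by
      have := div_mul_cancel₀ ρ hden.ne'
      rw [← hρ'] at this
      linarith
    rw [this]
    calc 2 * e * ρ * ρ' ≤ 2 * (1 / δ₀ ^ 2) * ρ * (2 * ρ) := by gcongr
      _ = _ := by ring
  have hrr : ρ = ρ' / (1 + (1 / b - 1 / a) * ρ') := by
    have h0 := div_mul_cancel₀ ρ hden.ne'
    rw [← hρ'] at h0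
    rw [hl, eq_div_iff (by positivity)]
    linarith
  rw [od_ftc hα0 ha0 hb0 hρ (by linarith), od_ftc hα0 hb0 ha0 hρ (by linarith),
    od_cov ha0 hb0 hρ'0 (by linarith) hrr (by linarith)]
  have hba : (b - a) / (2 * (b * a)) = -e := by rw [he]; field_simp; ring
  rw [hba, ← he]
  have hi := od_int (α := α) (-α) hα0 hb0 hρ (show ρ ≤ a by linarith)
  have hi' := od_int (α := α) (-α) hα0 hb0 hρ'0 (show ρ' ≤ a by linarith)
  have hiρ : IntervalIntegrable (fun s => ((a - s) * (b + s)) ^ (α / 2 - 1) * s ^ (-α)) volume ρ ρ' :=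
    hi.mono_set (by
      rw [uIcc_of_le hrr', uIcc_of_le (by linarith)]
      exact Icc_subset_Icc_right (by linarith))
  have hsplit := intervalIntegral.integral_add_adjacent_intervals hiρ hi'
  have hK : (∫ s in ρ..ρ', ((a - s) * (b + s)) ^ (α / 2 - 1) * s ^ (-α)) ≤
      4 * (1 / δ₀ ^ 2) * (δ₀ ^ 2 / 2) ^ (α / 2 - 1) * ρ ^ (2 - α) := by
    have hc : (∫ s in ρ..ρ', ((a - s) * (b + s)) ^ (α / 2 - 1) * s ^ (-α)) ≤
        ∫ s in ρ..ρ', (δ₀ ^ 2 / 2) ^ (α / 2 - 1) * ρ ^ (-α) := by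
      apply intervalIntegral.integral_mono_on hrr' hiρ intervalIntegrable_const
      intro s hs
      have h1 := hs.1
      have h2 := hs.2
      apply mul_le_mul
      · apply Real.rpow_le_rpow_of_nonpos (by positivity) _ (by linarith)
        have : δ₀ / 2 ≤ a - s := by linarith
        have : δ₀ ≤ b + s := by linarith
        nlinarith
      · exact Real.rpow_le_rpow_of_nonpos hρ h1 (by linarith)
      · exact Real.rpow_nonneg (by linarith) _
      · positivity
    refine hc.trans ?_
    rw [intervalIntegral.integral_const, smul_eq_mul]
    have e1 : ρ ^ (2 - α) = ρ ^ 2 * ρ ^ (-α) := by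
      rw [← Real.rpow_natCast, ← Real.rpow_add hρ]; congr 1
    rw [e1]
    calc (ρ' - ρ) * ((δ₀ ^ 2 / 2) ^ (α / 2 - 1) * ρ ^ (-α))
        ≤ (4 * (1 / δ₀ ^ 2) * ρ ^ 2) * ((δ₀ ^ 2 / 2) ^ (α / 2 - 1) * ρ ^ (-α)) := by
          gcongr
      _ = _ := by ring
  have hKe : e * (∫ s in ρ..ρ', ((a - s) * (b + s)) ^ (α / 2 - 1) * s ^ (-α)) ≤
      4 * (1 / δ₀ ^ 2) ^ 2 * (δ₀ ^ 2 / 2) ^ (α / 2 - 1) * ρ ^ (2 - α) := by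
    calc _ ≤ e * (4 * (1 / δ₀ ^ 2) * (δ₀ ^ 2 / 2) ^ (α / 2 - 1) * ρ ^ (2 - α)) := by gcongr
      _ ≤ (1 / δ₀ ^ 2) * (4 * (1 / δ₀ ^ 2) * (δ₀ ^ 2 / 2) ^ (α / 2 - 1) * ρ ^ (2 - α)) := by gcongr
      _ = _ := by ring
  -- AM-GM part
  have hX : 0 < (a - ρ) * (b + ρ) := mul_pos (by linarith) (by linarith)
  have hY : 0 < (b - ρ) * (a + ρ) := mul_pos (by linarith) (by linarith)
  have hamgm : 2 * (a * b) ^ (α / 2) * (1 - ρ ^ 2 * (2 / δ₀ ^ 2)) ≤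
      ((a - ρ) * (b + ρ)) ^ (α / 2) + ((b - ρ) * (a + ρ)) ^ (α / 2) := by
    exact od_amgm hα0 hα2 hδ ha hb hρ hρδ
  have hmainpos : 0 ≤ ρ ^ (-α) / (α * (a * b)) := by positivity
  have hm := mul_le_mul_of_nonneg_right hamgm hmainpos
  have eab : (a * b) ^ (α / 2) = (a * b) ^ (α / 2 - 1) * (a * b) := by
    rw [← Real.rpow_add_one (by positivity)]; congr 1; ring
  have eL : 2 * (a * b) ^ (α / 2) * (1 - ρ ^ 2 * (2 / δ₀ ^ 2)) * (ρ ^ (-α) / (α * (a * b))) =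
      2 * (a * b) ^ (α / 2 - 1) * ρ ^ (-α) / α -
        (2 / α) * (a * b) ^ (α / 2 - 1) * (2 / δ₀ ^ 2) * ρ ^ (2 - α) := by
    have e1 : ρ ^ (2 - α) = ρ ^ 2 * ρ ^ (-α) := by
      rw [← Real.rpow_natCast, ← Real.rpow_add hρ]; congr 1
    rw [eab, e1]; field_simp
  have hmono : (2 / α) * (a * b) ^ (α / 2 - 1) * (2 / δ₀ ^ 2) * ρ ^ (2 - α) ≤
      (2 / α) * (δ₀ ^ 2) ^ (α / 2 - 1) * (2 / δ₀ ^ 2) * ρ ^ (2 - α) := by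
    have := Real.rpow_le_rpow_of_nonpos (by positivity) hδab (show α / 2 - 1 ≤ 0 by linarith)
    gcongr
  rw [eL] at hm
  rw [← hsplit]
  have efin : ((b - ρ) * (a + ρ)) ^ (α / 2) * ρ ^ (-α) / (α * (b * a)) =
      ((b - ρ) * (a + ρ)) ^ (α / 2) * (ρ ^ (-α) / (α * (a * b))) := by
    rw [mul_comm b a]; ring
  have efin2 : ((a - ρ) * (b + ρ)) ^ (α / 2) * ρ ^ (-α) / (α * (a * b)) =
      ((a - ρ) * (b + ρ)) ^ (α / 2) * (ρ ^ (-α) / (α * (a * b))) := by ring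
  rw [efin, efin2]
  linarith

lemma od_main {α δ₀ : ℝ} (hα0 : 0 < α) (hα2 : α < 2) (hδ : 0 < δ₀) (hδ1 : δ₀ ≤ 1) :
    ∃ C : ℝ, 0 ≤ C ∧ ∀ a b ρ : ℝ, δ₀ ≤ a → a ≤ 2 → δ₀ ≤ b → b ≤ 2 → 0 < ρ → ρ ≤ δ₀ ^ 2 / 4 →
    2 * (a * b) ^ (α / 2 - 1) * ρ ^ (-α) / α - C * ρ ^ (2 - α) ≤
    (∫ s in ρ..a, ((a - s) * (b + s)) ^ (α / 2 - 1) * s ^ (-1 - α)) +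
      ∫ s in ρ..b, ((b - s) * (a + s)) ^ (α / 2 - 1) * s ^ (-1 - α) := by
  refine ⟨(2 / α) * (δ₀ ^ 2) ^ (α / 2 - 1) * (2 / δ₀ ^ 2)
        + 4 * (1 / δ₀ ^ 2) ^ 2 * (δ₀ ^ 2 / 2) ^ (α / 2 - 1), by positivity, ?_⟩
  intro a b ρ ha ha2 hb hb2 hρ hρ0
  rcases le_total b a with h | h
  · exact od_main_aux hα0 hα2 hδ hδ1 ha ha2 hb hb2 h hρ hρ0
  · have := od_main_aux hα0 hα2 hδ hδ1 hb hb2 ha ha2 h hρ hρ0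
    rw [mul_comm a b]
    linarith

/-- truncated kernel -/
def kern (N : ℕ) (α ρ : ℝ) (k : EN N) : ℝ := if ρ < ‖k‖ then ‖k‖ ^ (-((N : ℝ) + α)) else 0

/-- truncated fractional Laplacian without constant -/
def trunc (N : ℕ) (α ρ : ℝ) (v : EN N → ℝ) (x : EN N) : ℝ :=
  ∫ k, kern N α ρ k * (v (x + k) - v x)

/-- singular harmonic function on the ball -/
def hB (N : ℕ) (α : ℝ) (x : EN N) : ℝ := if ‖x‖ < 1 then (1 - ‖x‖ ^ 2) ^ (α / 2 - 1) else 0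

lemma kern_nonneg (N : ℕ) (α ρ : ℝ) (k : EN N) : 0 ≤ kern N α ρ k := by
  unfold kern; split_ifs <;> positivity

lemma kern_neg (N : ℕ) (α ρ : ℝ) (k : EN N) : kern N α ρ (-k) = kern N α ρ k := by
  unfold kern; rw [norm_neg]

lemma kern_le {N : ℕ} {α ρ : ℝ} (hα : 0 < α) (hρ : 0 < ρ) (k : EN N) :
    kern N α ρ k ≤ ρ ^ (-((N : ℝ) + α)) := by
  unfold kern
  split_ifs with h
  · exact Real.rpow_le_rpow_of_nonpos hρ h.le (by linarith [(Nat.cast_nonneg N : (0:ℝ) ≤ N)])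
  · positivity

lemma kern_meas (N : ℕ) (α ρ : ℝ) : Measurable (kern N α ρ) := by
  unfold kern
  apply Measurable.ite
  · exact measurableSet_lt measurable_const measurable_norm
  · fun_prop
  · fun_prop

lemma radial_int {N : ℕ} (hN : 3 ≤ N) {f : ℝ → ℝ}
    (hf : IntegrableOn (fun y : ℝ => y ^ (N - 1) * f y) (Ioi 0)) :
    Integrable (fun x : EN N => f ‖x‖) := by
  have : Nonempty (Fin N) := ⟨⟨0, by omega⟩⟩
  rw [integrable_fun_norm_addHaar]
  simpa using hf

lemma pow_rpow_aux {N : ℕ} (hN : 3 ≤ N) {y c : ℝ} (hy : 0 < y) :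
    y ^ (N - 1) * y ^ (-((N : ℝ) + c)) = y ^ (-1 - c) := by
  rw [← Real.rpow_natCast, ← Real.rpow_add hy]
  congr 1
  rw [Nat.cast_sub (by omega)]; push_cast; ring

lemma kern_int {N : ℕ} (hN : 3 ≤ N) {α ρ : ℝ} (hα : 0 < α) (hρ : 0 < ρ) :
    Integrable (kern N α ρ) := by
  unfold kern
  refine radial_int hN (f := fun y => if ρ < y then y ^ (-((N : ℝ) + α)) else 0) ?_
  have h1 : IntegrableOn (fun y : ℝ => y ^ (-1 - α)) (Ioi ρ) :=
    integrableOn_Ioi_rpow_of_lt (by linarith) hρ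
  have h2 : Integrable ((Ioi ρ).indicator (fun y : ℝ => y ^ (-1 - α))) :=
    (integrable_indicator_iff measurableSet_Ioi).2 h1
  refine (h2.integrableOn (s := Ioi 0)).congr_fun ?_ measurableSet_Ioi
  intro y hy
  by_cases h : ρ < y
  · simp only [indicator, mem_Ioi, h, if_true]
    exact (pow_rpow_aux hN (mem_Ioi.1 hy)).symm
  · simp [h]

lemma trunc_eq (N : ℕ) (α ρ : ℝ) (v : EN N → ℝ) (x : EN N) :
    ∫ y in {y : EN N | ρ < dist y x}, (v y - v x) / dist y x ^ ((N : ℝ) + α) = trunc N α ρ v x := by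
  unfold trunc
  rw [← integral_indicator (measurableSet_lt measurable_const (by fun_prop)),
    ← integral_add_left_eq_self _ x]
  congr 1
  ext k
  unfold kern
  simp only [indicator, Set.mem_ofPred_eq, dist_self_add_left]
  split_ifs with h
  · rw [Real.rpow_neg (norm_nonneg _)]; field_simp
  · simp

lemma hB_meas (N : ℕ) (α : ℝ) : Measurable (hB N α) := by
  unfold hB
  apply Measurable.ite
  · exact measurableSet_lt measurable_norm measurable_const
  · fun_prop
  · fun_prop

lemma hB_nonneg (N : ℕ) (α : ℝ) (x : EN N) : 0 ≤ hB N α x := by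
  unfold hB
  split_ifs with h
  · apply Real.rpow_nonneg; nlinarith [norm_nonneg x]
  · exact le_rfl

lemma hB_int {N : ℕ} (hN : 3 ≤ N) {α : ℝ} (hα : 0 < α) (hα2 : α < 2) : Integrable (hB N α) := by
  unfold hB
  refine radial_int hN (f := fun y => if y < 1 then (1 - y ^ 2) ^ (α / 2 - 1) else 0) ?_
  have h1 : IntervalIntegrable (fun s : ℝ => (1 - s) ^ (α / 2 - 1)) volume 0 1 := by
    have := (intervalIntegral.intervalIntegrable_rpow' (a := 1) (b := 0)
      (r := α / 2 - 1) (by linarith)).comp_sub_left 1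
    simpa using this
  rw [intervalIntegrable_iff_integrableOn_Ioo_of_le zero_le_one] at h1
  have h2 := (integrable_indicator_iff measurableSet_Ioo).2 h1
  refine (h2.integrableOn (s := Ioi 0)).mono' ?_ ?_
  · apply Measurable.aestronglyMeasurable
    apply Measurable.mul (by fun_prop)
    apply Measurable.ite (measurableSet_lt measurable_id measurable_const) (by fun_prop) (by fun_prop)
  · filter_upwards [ae_restrict_mem measurableSet_Ioi] with y hy
    have hy : 0 < y := hy
    by_cases h : y < 1
    · simp only [h, if_true, indicator, mem_Ioo, hy, and_self]
      have hp : 0 < 1 - y ^ 2 := by nlinarith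
      rw [Real.norm_of_nonneg (by positivity)]
      calc y ^ (N - 1) * (1 - y ^ 2) ^ (α / 2 - 1) ≤ 1 * (1 - y ^ 2) ^ (α / 2 - 1) := by
            gcongr; exact pow_le_one₀ hy.le h.le
        _ = (1 - y ^ 2) ^ (α / 2 - 1) := one_mul _
        _ ≤ _ := Real.rpow_le_rpow_of_nonpos (by linarith) (by nlinarith) (by linarith)
    · simp [h]

lemma polar_ge {N : ℕ} (hN : 3 ≤ N) {F : EN N → ℝ} (hF : Integrable F) (C : ℝ)
    (h : ∀ θ : EN N, ‖θ‖ = 1 → C ≤ ∫ s in Ioi (0:ℝ), s ^ (N - 1) * F (s • θ)) :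
    (sphereMeasure N).real univ * C ≤ ∫ x, F x := by
  have : Nonempty (Fin N) := ⟨⟨0, by omega⟩⟩
  let μ : Measure (EN N) := volume
  let G : sphere (0 : EN N) 1 × Ioi (0:ℝ) → ℝ := fun p => F ((p.2 : ℝ) • (p.1 : EN N))
  have hcomp : ∀ x : ({0}ᶜ : Set (EN N)), G (homeomorphUnitSphereProd (EN N) x) = F x := by
    intro x
    simp only [G]
    congr 1
    simp only [homeomorphUnitSphereProd_apply_fst_coe, homeomorphUnitSphereProd_apply_snd_coe]
    exact smul_inv_smul₀ (norm_ne_zero_iff.2 x.2) _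
  have hdim : Module.finrank ℝ (EN N) = N := by simp
  have e1 : ∫ x, F x = ∫ p, G p ∂(μ.toSphere.prod (.volumeIoiPow (N - 1))) := by
    calc ∫ x, F x = ∫ x : ({(0)}ᶜ : Set (EN N)), F x ∂(μ.comap (↑)) := by
          rw [integral_subtype_comap (measurableSet_singleton _).compl fun x ↦ F x,
            restrict_compl_singleton]
      _ = ∫ x : ({(0)}ᶜ : Set (EN N)), G (homeomorphUnitSphereProd (EN N) x) ∂(μ.comap (↑)) := by
          simp only [hcomp]
      _ = _ := by
          have := μ.measurePreserving_homeomorphUnitSphereProd.integral_comp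
            (Homeomorph.measurableEmbedding _) G
          rw [hdim] at this
          exact this
  have hGi : Integrable G (μ.toSphere.prod (.volumeIoiPow (N - 1))) := by
    have h1 := μ.measurePreserving_homeomorphUnitSphereProd.integrable_comp_emb (g := G)
      (Homeomorph.measurableEmbedding _)
    rw [hdim] at h1
    rw [← h1]
    have h2 : G ∘ (homeomorphUnitSphereProd (EN N)) = F ∘ Subtype.val := by
      ext x; exact hcomp x
    rw [h2, ← integrableOn_iff_comap_subtypeVal (by measurability)]
    exact hF.integrableOn
  rw [e1, integral_prod _ hGi]
  have e2 : ∀ θ : sphere (0 : EN N) 1, C ≤ ∫ s, G (θ, s) ∂(Measure.volumeIoiPow (N - 1)) := by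
    intro θ
    have hθ : ‖(θ : EN N)‖ = 1 := by simp
    refine (h θ hθ).trans (le_of_eq ?_)
    simp only [Measure.volumeIoiPow, ENNReal.ofReal]
    rw [integral_withDensity_eq_integral_smul,
        integral_subtype_comap measurableSet_Ioi fun a ↦ Real.toNNReal (a ^ (N - 1)) • F (a • (θ : EN N)),
        setIntegral_congr_fun measurableSet_Ioi fun x hx ↦ ?_]
    · rw [NNReal.smul_def, Real.coe_toNNReal _ (pow_nonneg hx.out.le _), smul_eq_mul]
    · exact (measurable_subtype_coe.pow_const _).real_toNNReal
  have e3 : ∫ _θ : sphere (0 : EN N) 1, C ∂μ.toSphere = (sphereMeasure N).real univ * C := by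
    rw [integral_const, smul_eq_mul]; rfl
  rw [← e3]
  exact integral_mono (integrable_const _) hGi.integral_prod_left e2

lemma trunc_integrable {N : ℕ} (hN : 3 ≤ N) {α ρ : ℝ} (hα : 0 < α) (hρ : 0 < ρ) {v : EN N → ℝ}
    (hv : Integrable v) (x : EN N) (c : ℝ) :
    Integrable (fun k => kern N α ρ k * (v (x + k) - c)) := by
  have h1 : Integrable (fun k => kern N α ρ k * v (x + k)) := by
    refine (hv.comp_add_left x).bdd_mul (c := ρ ^ (-((N : ℝ) + α)))
      (kern_meas N α ρ).aestronglyMeasurable (ae_of_all _ fun k => ?_)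
    rw [Real.norm_of_nonneg (kern_nonneg _ _ _ _)]
    exact kern_le hα hρ k
  have h2 : Integrable (fun k => kern N α ρ k * c) := (kern_int hN hα hρ).mul_const c
  simp only [mul_sub]
  exact h1.sub h2

lemma trunc_integrable' {N : ℕ} (hN : 3 ≤ N) {α ρ : ℝ} (hα : 0 < α) (hρ : 0 < ρ) {v : EN N → ℝ}
    (hv : Integrable v) (x : EN N) (c : ℝ) :
    Integrable (fun k => kern N α ρ k * (v (x - k) - c)) := by
  have := (trunc_integrable hN hα hρ hv x c).comp_neg
  simpa only [kern_neg, ← sub_eq_add_neg] using this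

lemma trunc_symm {N : ℕ} (α ρ : ℝ) (v : EN N → ℝ) (x : EN N) :
    trunc N α ρ v x = ∫ k, kern N α ρ k * (v (x - k) - v x) := by
  unfold trunc
  rw [← integral_neg_eq_self]
  simp only [kern_neg, ← sub_eq_add_neg]

lemma trunc_sym2 {N : ℕ} (hN : 3 ≤ N) {α ρ : ℝ} (hα : 0 < α) (hρ : 0 < ρ) {v : EN N → ℝ}
    (hv : Integrable v) (x : EN N) :
    2 * trunc N α ρ v x = ∫ k, kern N α ρ k * (v (x + k) + v (x - k) - 2 * v x) := by
  have : 2 * trunc N α ρ v x = trunc N α ρ v x + ∫ k, kern N α ρ k * (v (x - k) - v x) := by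
    rw [← trunc_symm]; ring
  rw [this, trunc, ← integral_add (trunc_integrable hN hα hρ hv x _)
    (trunc_integrable' hN hα hρ hv x _)]
  congr 1; ext k; ring

lemma sym2_integrable {N : ℕ} (hN : 3 ≤ N) {α ρ : ℝ} (hα : 0 < α) (hρ : 0 < ρ) {v : EN N → ℝ}
    (hv : Integrable v) (x : EN N) :
    Integrable (fun k => kern N α ρ k * (v (x + k) + v (x - k) - 2 * v x)) := by
  refine ((trunc_integrable hN hα hρ hv x (v x)).add (trunc_integrable' hN hα hρ hv x (v x))).congr ?_
  refine ae_of_all _ fun k => ?_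
  simp only [Pi.add_apply]; ring

lemma hB_line {N : ℕ} {α : ℝ} (hα2 : α < 2) {a b s : ℝ} (y : EN N) (hb : 0 < b) (hs : 0 < s)
    (h : 1 - ‖y‖ ^ 2 = (a - s) * (b + s)) :
    hB N α y = if s ≤ a then ((a - s) * (b + s)) ^ (α / 2 - 1) else 0 := by
  unfold hB
  rcases lt_trichotomy s a with h1 | h1 | h1
  · have : 0 < (a - s) * (b + s) := by apply mul_pos <;> linarith
    have : ‖y‖ < 1 := by nlinarith [norm_nonneg y]
    rw [if_pos this, if_pos h1.le, h]
  · subst h1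
    have : ‖y‖ = 1 := by
      have : ‖y‖ ^ 2 = 1 := by linarith
      nlinarith [norm_nonneg y]
    simp [this, Real.zero_rpow (show α / 2 - 1 ≠ 0 by linarith)]
  · have : (a - s) * (b + s) < 0 := by apply mul_neg_of_neg_of_pos <;> linarith
    have : ¬ ‖y‖ < 1 := by intro h'; nlinarith [norm_nonneg y]
    rw [if_neg this, if_neg (by linarith)]

set_option maxHeartbeats 1000000 in
lemma inner_ge {N : ℕ} (hN : 3 ≤ N) {α r : ℝ} (hα0 : 0 < α) (hα2 : α < 2) (hr0 : 0 ≤ r) (hr : r < 1) :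
    ∃ C, 0 ≤ C ∧ ∀ x θ : EN N, ‖x‖ ≤ r → ‖θ‖ = 1 → ∀ ρ, 0 < ρ → ρ ≤ (1 - r) ^ 2 / 4 →
      -C * ρ ^ (2 - α) ≤ ∫ s in Ioi (0:ℝ), s ^ (N - 1) *
        (kern N α ρ (s • θ) * (hB N α (x + s • θ) + hB N α (x - s • θ) - 2 * hB N α x)) := by
  obtain ⟨C, hC, H⟩ := od_main hα0 hα2 (show 0 < 1 - r by linarith) (by linarith)
  refine ⟨C, hC, fun x θ hx hθ ρ hρ hρ2 => ?_⟩
  set p := inner ℝ x θ with hp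
  have hpx : p ^ 2 ≤ ‖x‖ ^ 2 := by
    have := abs_real_inner_le_norm x θ
    rw [hθ, mul_one] at this
    rw [← sq_abs p]; gcongr
  have hx0 := norm_nonneg x
  set q := √(p ^ 2 + 1 - ‖x‖ ^ 2) with hq
  have hqq : q ^ 2 = p ^ 2 + 1 - ‖x‖ ^ 2 := Real.sq_sqrt (by nlinarith)
  have hq0 : 0 ≤ q := Real.sqrt_nonneg _
  have hq1 : q ≤ 1 := by nlinarith
  have hpabs := abs_le_of_sq_le_sq' hpx hx0
  have hqp : p ^ 2 + (1-r)^2 + 2 * (1 - r) * r ≤ q ^ 2 := by nlinarith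
  have hqp2 : |p| + (1 - r) ≤ q := by
    have : |p| ≤ r := (abs_le.2 hpabs).trans hx
    refine (sq_le_sq₀ (by have := abs_nonneg p; linarith) hq0).1 ?_
    rw [← sq_abs p] at hqp
    nlinarith [abs_nonneg p]
  have hp1 := le_abs_self p
  have hp2 := neg_abs_le p
  set a := -p + q with ha
  set b := p + q with hb
  have hab : a * b = 1 - ‖x‖ ^ 2 := by rw [ha, hb]; linear_combination hqq
  have ha1 : 1 - r ≤ a := by linarith
  have hb1 : 1 - r ≤ b := by linarith
  have ha2 : a ≤ 2 := by linarith
  have hb2 : b ≤ 2 := by linarith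
  have hρa : ρ ≤ a := by nlinarith
  have hρb : ρ ≤ b := by nlinarith
  have key := H a b ρ ha1 ha2 hb1 hb2 hρ hρ2
  have hl1 : ∀ s : ℝ, 1 - ‖x + s • θ‖ ^ 2 = (a - s) * (b + s) := by
    intro s
    rw [norm_add_sq_real, norm_smul, inner_smul_right, hθ, ← hp, Real.norm_eq_abs, mul_one, sq_abs]
    rw [ha, hb]; linear_combination -hqq
  have hl2 : ∀ s : ℝ, 1 - ‖x - s • θ‖ ^ 2 = (b - s) * (a + s) := by
    intro s
    rw [norm_sub_sq_real, norm_smul, inner_smul_right, hθ, ← hp, Real.norm_eq_abs, mul_one, sq_abs]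
    rw [ha, hb]; linear_combination -hqq
  have hhx : hB N α x = (a * b) ^ (α / 2 - 1) := by
    unfold hB; rw [if_pos (by linarith), hab]
  let f1 : ℝ → ℝ := fun s => ((a-s)*(b+s))^(α/2-1)*s^(-1-α)
  have hf1 : f1 = _ := rfl
  let f2 : ℝ → ℝ := fun s => ((b-s)*(a+s))^(α/2-1)*s^(-1-α)
  have hf2 : f2 = _ := rfl
  let f3 : ℝ → ℝ := fun s => s^(-1-α)
  have hf3 : f3 = _ := rfl
  have hi1 : IntegrableOn f1 (Ioc ρ a) := by
    have := od_int (-1-α) hα0 (show 0 < b by linarith) hρ hρa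
    rwa [intervalIntegrable_iff_integrableOn_Ioc_of_le hρa] at this
  have hi2 : IntegrableOn f2 (Ioc ρ b) := by
    have := od_int (-1-α) hα0 (show 0 < a by linarith) hρ hρb
    rwa [intervalIntegrable_iff_integrableOn_Ioc_of_le hρb] at this
  have hi3 : IntegrableOn f3 (Ioi ρ) := integrableOn_Ioi_rpow_of_lt (by linarith) hρ
  have hI3 : ∫ s in Ioi ρ, f3 s = ρ ^ (-α) / α := by
    rw [hf3, integral_Ioi_rpow_of_lt (by linarith) hρ]
    rw [show -1 - α + 1 = -α by ring]; field_simp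
  have j1 := (integrable_indicator_iff measurableSet_Ioc).2 hi1
  have j2 := (integrable_indicator_iff measurableSet_Ioc).2 hi2
  have j3 := (integrable_indicator_iff measurableSet_Ioi).2 hi3
  have e : ∀ s ∈ Ioi (0:ℝ), s ^ (N - 1) *
        (kern N α ρ (s • θ) * (hB N α (x + s • θ) + hB N α (x - s • θ) - 2 * hB N α x)) =
        (Ioc ρ a).indicator f1 s + (Ioc ρ b).indicator f2 s
          - 2 * (a * b) ^ (α / 2 - 1) * (Ioi ρ).indicator f3 s := by
    intro s hs
    have hs : 0 < s := hs
    rw [hB_line hα2 (x + s • θ) (by linarith) hs (hl1 s), hB_line hα2 (x - s • θ) (by linarith) hs (hl2 s), hhx]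
    have hn : ‖s • θ‖ = s := by rw [norm_smul, hθ, mul_one, Real.norm_of_nonneg hs.le]
    unfold kern
    rw [hn]
    by_cases h : ρ < s
    · simp only [h, if_true, indicator, mem_Ioc, mem_Ioi, true_and, hf1, hf2, hf3]
      rw [← mul_assoc, pow_rpow_aux hN hs]
      split_ifs <;> ring
    · simp [h]
  rw [setIntegral_congr_fun measurableSet_Ioi e]
  have hsub : ∀ g : ℝ → ℝ, ∀ S : Set ℝ, MeasurableSet S → S ⊆ Ioi 0 →
      ∫ s in Ioi (0:ℝ), S.indicator g s = ∫ s in S, g s := by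
    intro g S hS h
    rw [setIntegral_indicator hS, inter_eq_self_of_subset_right h]
  have k1 := hsub f1 (Ioc ρ a) measurableSet_Ioc (fun s hs => hρ.trans hs.1)
  have k2 := hsub f2 (Ioc ρ b) measurableSet_Ioc (fun s hs => hρ.trans hs.1)
  have k3 := hsub f3 (Ioi ρ) measurableSet_Ioi (fun s hs => hρ.trans hs)
  rw [integral_sub (f := fun s => (Ioc ρ a).indicator f1 s + (Ioc ρ b).indicator f2 s)
    (j1.integrableOn.add j2.integrableOn) (j3.integrableOn.const_mul _),
    integral_add j1.integrableOn j2.integrableOn, integral_const_mul, k1, k2, k3, hI3]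
  rw [intervalIntegral.integral_of_le hρa, intervalIntegral.integral_of_le hρb] at key
  have : 2*(a*b)^(α/2-1)*ρ^(-α)/α = 2*(a*b)^(α/2-1)*(ρ^(-α)/α) := by ring
  rw [this] at key
  linarith

lemma trunc_h_ge {N : ℕ} (hN : 3 ≤ N) {α r : ℝ} (hα0 : 0 < α) (hα2 : α < 2) (hr0 : 0 ≤ r) (hr : r < 1) :
    ∃ C, 0 ≤ C ∧ ∀ x : EN N, ‖x‖ ≤ r → ∀ ρ, 0 < ρ → ρ ≤ (1 - r) ^ 2 / 4 →
      -C * ρ ^ (2 - α) ≤ trunc N α ρ (hB N α) x := by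
  obtain ⟨C, hC, H⟩ := inner_ge hN hα0 hα2 hr0 hr
  refine ⟨(sphereMeasure N).real univ * C, by positivity, fun x hx ρ hρ hρ2 => ?_⟩
  have h := polar_ge hN (sym2_integrable hN hα0 hρ (hB_int hN hα0 hα2) x) (-C * ρ ^ (2 - α))
    (fun θ hθ => H x θ hx hθ ρ hρ hρ2)
  rw [← trunc_sym2 hN hα0 hρ (hB_int hN hα0 hα2) x] at h
  have : 0 ≤ (sphereMeasure N).real univ * C * ρ ^ (2 - α) := by positivity
  nlinarith

lemma second_diff {N : ℕ} {φ : EN N → ℝ} (hφ : ContDiff ℝ (⊤ : ℕ∞) φ) (hc : HasCompactSupport φ) :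
    ∃ C, 0 ≤ C ∧ ∀ x k, |φ (x + k) + φ (x - k) - 2 * φ x| ≤ C * min (‖k‖ ^ 2) 1 := by
  obtain ⟨M, hM⟩ := hc.exists_bound_of_continuous hφ.continuous
  have hd : ContDiff ℝ 1 (fderiv ℝ φ) := hφ.fderiv_right (by norm_cast)
  obtain ⟨K, hK⟩ := ContDiff.lipschitzWith_of_hasCompactSupport (𝕂 := ℝ) (hc.fderiv (𝕜 := ℝ)) hd (by simp)
  have hdiff : Differentiable ℝ φ := hφ.differentiable (by simp)
  have h1 : ∀ x k, |φ (x + k) - φ x - fderiv ℝ φ x k| ≤ K * ‖k‖ ^ 2 := by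
    intro x k
    have := (convex_closedBall x ‖k‖).norm_image_sub_le_of_norm_hasFDerivWithin_le'
      (f := φ) (f' := fderiv ℝ φ) (φ := fderiv ℝ φ x) (C := K * ‖k‖) (x := x) (y := x + k)
      (fun y _ => (hdiff y).hasFDerivAt.hasFDerivWithinAt)
      (fun y hy => by
        have := hK.dist_le_mul y x
        rw [dist_eq_norm] at this
        refine this.trans ?_
        gcongr
        exact hy) (by simp) (by simp)
    simp only [add_sub_cancel_left, Real.norm_eq_abs] at this
    nlinarith
  have hM0 : 0 ≤ M := (norm_nonneg _).trans (hM 0)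
  refine ⟨2 * K + 4 * M, by positivity, fun x k => ?_⟩
  rcases le_total (‖k‖ ^ 2) 1 with h | h
  · rw [min_eq_left h]
    have e1 := h1 x k
    have e2 := h1 x (-k)
    rw [norm_neg, map_neg, ← sub_eq_add_neg] at e2
    rw [abs_le] at *
    have : 0 ≤ 4 * M * ‖k‖ ^ 2 := by positivity
    constructor <;> nlinarith
  · rw [min_eq_right h]
    have e1 := hM (x + k)
    have e2 := hM (x - k)
    have e3 := hM x
    rw [Real.norm_eq_abs, abs_le] at *
    have : (0:ℝ) ≤ K := K.2
    constructor <;> linarith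

lemma levy_int {N : ℕ} (hN : 3 ≤ N) {α : ℝ} (hα0 : 0 < α) (hα2 : α < 2) :
    Integrable (fun k : EN N => min (‖k‖ ^ 2) 1 * ‖k‖ ^ (-((N : ℝ) + α))) := by
  refine radial_int hN (f := fun y => min (y ^ 2) 1 * y ^ (-((N : ℝ) + α))) ?_
  have h : ∀ y ∈ Ioi (0:ℝ), y ^ (N - 1) * (min (y ^ 2) 1 * y ^ (-((N : ℝ) + α)))
      = min (y ^ 2) 1 * y ^ (-1 - α) := by
    intro y hy
    rw [← pow_rpow_aux hN (mem_Ioi.1 hy)]; ring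
  rw [integrableOn_congr_fun h measurableSet_Ioi, ← Ioc_union_Ioi_eq_Ioi (zero_le_one (α := ℝ))]
  refine IntegrableOn.union ?_ ?_
  · have : IntegrableOn (fun y : ℝ => y ^ (1 - α)) (Ioc 0 1) := by
      rw [← intervalIntegrable_iff_integrableOn_Ioc_of_le zero_le_one]
      exact intervalIntegral.intervalIntegrable_rpow' (by linarith)
    refine this.congr_fun ?_ measurableSet_Ioc
    intro y hy
    have hy0 : 0 < y := hy.1
    simp only
    rw [min_eq_left (by nlinarith [hy.1, hy.2]), ← Real.rpow_natCast, ← Real.rpow_add hy0]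
    congr 1; push_cast; ring
  · have : IntegrableOn (fun y : ℝ => y ^ (-1 - α)) (Ioi 1) :=
      integrableOn_Ioi_rpow_of_lt (by linarith) one_pos
    refine this.congr_fun ?_ measurableSet_Ioi
    intro y hy
    have hy : 1 < y := hy
    simp only
    rw [min_eq_right (by nlinarith), one_mul]

lemma kern_le' {N : ℕ} {α ρ : ℝ} (k : EN N) : kern N α ρ k ≤ ‖k‖ ^ (-((N : ℝ) + α)) := by
  unfold kern
  split_ifs with h
  · exact le_rfl
  · positivity

lemma kern_tendsto {N : ℕ} {α : ℝ} {k : EN N} (hk : k ≠ 0) :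
    Tendsto (fun ρ => kern N α ρ k) (𝓝[>] 0) (𝓝 (‖k‖ ^ (-((N : ℝ) + α)))) := by
  apply tendsto_const_nhds.congr'
  have : Iio ‖k‖ ∈ 𝓝[>] (0:ℝ) := nhdsWithin_le_nhds (Iio_mem_nhds (norm_pos_iff.2 hk))
  filter_upwards [this] with ρ hρ
  unfold kern
  rw [if_pos (mem_Iio.1 hρ)]

lemma test_bound {N : ℕ} (hN : 3 ≤ N) {α : ℝ} (hα0 : 0 < α) (hα2 : α < 2) {φ : EN N → ℝ}
    (hφ : ContDiff ℝ (⊤ : ℕ∞) φ) (hc : HasCompactSupport φ) :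
    ∃ M, (∀ ρ, 0 < ρ → ∀ x, |trunc N α ρ φ x| ≤ M) ∧
      ∀ x, ∃ L, Tendsto (fun ρ => trunc N α ρ φ x) (𝓝[>] 0) (𝓝 L) := by
  obtain ⟨C, hC, H⟩ := second_diff hφ hc
  have hi : Integrable φ := hφ.continuous.integrable_of_hasCompactSupport hc
  have hg := (levy_int hN hα0 hα2).const_mul C
  have hb : ∀ ρ x k, ‖kern N α ρ k * (φ (x + k) + φ (x - k) - 2 * φ x)‖ ≤
      C * (min (‖k‖ ^ 2) 1 * ‖k‖ ^ (-((N : ℝ) + α))) := by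
    intro ρ x k
    rw [norm_mul, Real.norm_of_nonneg (kern_nonneg _ _ _ _), Real.norm_eq_abs]
    calc _ ≤ ‖k‖ ^ (-((N : ℝ) + α)) * (C * min (‖k‖ ^ 2) 1) :=
          mul_le_mul (kern_le' k) (H x k) (abs_nonneg _) (by positivity)
      _ = _ := by ring
  have hm : ∀ ρ x, AEStronglyMeasurable (fun k => kern N α ρ k * (φ (x + k) + φ (x - k) - 2 * φ x)) volume := by
    intro ρ x
    have := hφ.continuous
    exact ((kern_meas N α ρ).mul (by fun_prop)).aestronglyMeasurable
  refine ⟨1 / 2 * ∫ k : EN N, C * (min (‖k‖ ^ 2) 1 * ‖k‖ ^ (-((N : ℝ) + α))), ?_, ?_⟩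
  · intro ρ hρ x
    have e := trunc_sym2 hN hα0 hρ hi x
    have := norm_integral_le_of_norm_le hg (ae_of_all _ (hb ρ x))
    rw [← e, Real.norm_eq_abs, abs_mul, abs_two] at this
    linarith
  · intro x
    refine ⟨1 / 2 * ∫ k : EN N, ‖k‖ ^ (-((N : ℝ) + α)) * (φ (x + k) + φ (x - k) - 2 * φ x), ?_⟩
    have : Tendsto (fun ρ => ∫ k, kern N α ρ k * (φ (x + k) + φ (x - k) - 2 * φ x)) (𝓝[>] 0)
        (𝓝 (∫ k : EN N, ‖k‖ ^ (-((N : ℝ) + α)) * (φ (x + k) + φ (x - k) - 2 * φ x))) := by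
      refine tendsto_integral_filter_of_dominated_convergence _ (Eventually.of_forall fun ρ => hm ρ x)
        (Eventually.of_forall fun ρ => ae_of_all _ (hb ρ x)) hg (ae_of_all _ fun k => ?_)
      by_cases hk : k = 0
      · subst hk
        have : φ (x + 0) + φ (x - 0) - 2 * φ x = 0 := by rw [add_zero, sub_zero]; ring
        simp only [this, mul_zero]; exact tendsto_const_nhds
      · exact (kern_tendsto hk).mul_const _
    refine (this.const_mul (1/2)).congr' ?_
    filter_upwards [self_mem_nhdsWithin] with ρ hρ
    rw [← trunc_sym2 hN hα0 hρ hi x]; ring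

lemma fracLap_tendsto {N : ℕ} (hN : 3 ≤ N) {α : ℝ} (hα0 : 0 < α) (hα2 : α < 2) {φ : EN N → ℝ}
    (hφ : ContDiff ℝ (⊤ : ℕ∞) φ) (hc : HasCompactSupport φ) (x : EN N) :
    Tendsto (fun ρ => fracLapCoeff N α * trunc N α ρ φ x) (𝓝[>] 0) (𝓝 (fracLap N α φ x)) := by
  obtain ⟨M, -, h⟩ := test_bound hN hα0 hα2 hφ hc
  obtain ⟨L, hL⟩ := h x
  have hex : ∃ L, HasFracLap N α φ x L := by
    refine ⟨fracLapCoeff N α * L, ?_⟩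
    unfold HasFracLap
    simp only [trunc_eq]
    exact hL.const_mul _
  have h2 := hex.choose_spec
  unfold fracLap
  rw [dif_pos hex]
  generalize hex.choose = L' at h2 ⊢
  unfold HasFracLap at h2
  simp only [trunc_eq] at h2
  exact h2

lemma trunc_smeas {N : ℕ} {α ρ : ℝ} {v : EN N → ℝ} (hv : Measurable v) :
    StronglyMeasurable (trunc N α ρ v) := by
  unfold trunc
  have : StronglyMeasurable (fun p : EN N × EN N => kern N α ρ p.2 * (v (p.1 + p.2) - v p.1)) := by
    apply Measurable.stronglyMeasurable
    exact ((kern_meas N α ρ).comp measurable_snd).mul (by fun_prop)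
  exact this.integral_prod_right

lemma dist_tendsto {N : ℕ} (hN : 3 ≤ N) {α : ℝ} (hα0 : 0 < α) (hα2 : α < 2) {φ u : EN N → ℝ}
    (hφ : ContDiff ℝ (⊤ : ℕ∞) φ) (hc : HasCompactSupport φ) (hu : Integrable u) :
    Tendsto (fun ρ => fracLapCoeff N α * ∫ x, u x * trunc N α ρ φ x) (𝓝[>] 0)
      (𝓝 (∫ x, u x * fracLap N α φ x)) := by
  obtain ⟨M, hM, -⟩ := test_bound hN hα0 hα2 hφ hc
  simp only [← integral_const_mul]
  refine tendsto_integral_filter_of_dominated_convergence (fun x => |fracLapCoeff N α| * M * ‖u x‖) ?_ ?_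
    (hu.norm.const_mul _) (ae_of_all _ fun x => ?_)
  · refine Eventually.of_forall fun ρ => ?_
    exact (hu.aestronglyMeasurable.mul
      (trunc_smeas hφ.continuous.measurable).aestronglyMeasurable).const_mul _
  · filter_upwards [self_mem_nhdsWithin] with ρ hρ
    refine ae_of_all _ fun x => ?_
    rw [norm_mul, norm_mul, Real.norm_eq_abs (fracLapCoeff N α), Real.norm_eq_abs (trunc N α ρ φ x)]
    have := mul_le_mul_of_nonneg_left (hM ρ hρ x)
      (mul_nonneg (abs_nonneg (fracLapCoeff N α)) (norm_nonneg (u x)))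
    linarith
  · refine ((fracLap_tendsto hN hα0 hα2 hφ hc x).const_mul (u x)).congr fun ρ => ?_
    ring

lemma swap1 {N : ℕ} (hN : 3 ≤ N) {α ρ : ℝ} (hα : 0 < α) (hρ : 0 < ρ) {w φ : EN N → ℝ}
    (hw : Integrable w) (hφ : Continuous φ) (hc : HasCompactSupport φ) :
    ∫ x, w x * trunc N α ρ φ x = ∫ k, kern N α ρ k * ∫ x, w x * (φ (x + k) - φ x) := by
  obtain ⟨M, hM⟩ := hc.exists_bound_of_continuous hφ
  unfold trunc
  simp only [← integral_const_mul]
  rw [integral_integral_swap]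
  · congr 1; ext k; congr 1; ext x; ring
  · have h1 : Integrable (fun p : EN N × EN N => w p.1 * kern N α ρ p.2) (volume.prod volume) :=
      hw.mul_prod (kern_int hN hα hρ)
    have h2 := h1.bdd_mul (c := M + M) (f := fun p : EN N × EN N => φ (p.1 + p.2) - φ p.1)
      (by apply Continuous.aestronglyMeasurable; fun_prop)
      (ae_of_all _ fun p => (norm_sub_le _ _).trans (add_le_add (hM _) (hM _)))
    refine h2.congr (ae_of_all _ fun p => ?_)
    simp only [Function.uncurry]; ring

lemma swap2 {N : ℕ} (hN : 3 ≤ N) {α ρ : ℝ} (hα : 0 < α) (hρ : 0 < ρ) {w φ : EN N → ℝ}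
    (hw : Integrable w) (hφ : Continuous φ) (hc : HasCompactSupport φ) :
    ∫ x, w x * trunc N α ρ φ x = ∫ x, φ x * trunc N α ρ w x := by
  rw [swap1 hN hα hρ hw hφ hc]
  obtain ⟨M, hM⟩ := hc.exists_bound_of_continuous hφ
  simp only [trunc_symm (v := w)]
  simp only [← integral_const_mul]
  symm
  rw [integral_integral_swap]
  · congr 1; ext k
    symm
    rw [integral_const_mul]
    have hb : ∀ k, Integrable (fun x => w x * φ (x + k)) := by
      intro k
      have := hw.bdd_mul (c := M) (f := fun x => φ (x + k))
        (by apply Continuous.aestronglyMeasurable; fun_prop) (ae_of_all _ fun x => hM _)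
      refine this.congr (ae_of_all _ fun x => ?_)
      simp only [mul_comm]
    have hb0 : Integrable (fun x => w x * φ x) := by simpa using hb 0
    have hb2 : Integrable (fun x => w (x - k) * φ x) := by
      have := (hb k).comp_sub_right k
      simpa using this
    have e1 : ∫ x, w x * (φ (x + k) - φ x) = (∫ x, w x * φ (x + k)) - ∫ x, w x * φ x := by
      rw [← integral_sub (hb k) hb0]; congr 1; ext x; ring
    have e2 : ∫ x, w x * φ (x + k) = ∫ x, w (x - k) * φ x := by
      rw [← integral_sub_right_eq_self _ k]; simp
    rw [e1, e2, ← integral_sub hb2 hb0, ← integral_const_mul]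
    congr 1; ext x; ring
  · have h1 : Integrable (fun p : EN N × EN N => w p.1 * kern N α ρ p.2) (volume.prod volume) :=
      hw.mul_prod (kern_int hN hα hρ)
    have h0 : Integrable (fun p : EN N × EN N => kern N α ρ p.2 * w (p.1 - p.2)) (volume.prod volume) := by
      have := (kern_int hN hα hρ).convolution_integrand (ContinuousLinearMap.mul ℝ ℝ) hw
      simpa using this
    have h2 := (h0.sub h1).bdd_mul (c := M) (f := fun p : EN N × EN N => φ p.1)
      (by apply Continuous.aestronglyMeasurable; fun_prop)
      (ae_of_all _ fun p => hM _)
    refine h2.congr (ae_of_all _ fun p => ?_)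
    simp only [Function.uncurry, Pi.sub_apply]; ring

lemma swap3 {N : ℕ} (hN : 3 ≤ N) {α ρ : ℝ} (hα : 0 < α) (hρ : 0 < ρ) {z η : EN N → ℝ}
    (hz : Integrable z) (hφ : Continuous η) (hc : HasCompactSupport η) (x : EN N)
    (hmin : ∀ x', ∫ y, z y * η (y - x) ≤ ∫ y, z y * η (y - x')) :
    0 ≤ ∫ y, z y * trunc N α ρ (fun y => η (y - x)) y := by
  obtain ⟨M, hM⟩ := hc.exists_bound_of_continuous hφ
  have hc' : HasCompactSupport (fun y => η (y - x)) :=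
    hc.comp_homeomorph (Homeomorph.subRight x)
  rw [swap1 hN hα hρ hz (by fun_prop) hc']
  refine integral_nonneg fun k => mul_nonneg (kern_nonneg _ _ _ _) ?_
  have hb : ∀ k, Integrable (fun y => z y * η (y - k)) := by
    intro k
    have := hz.bdd_mul (c := M) (f := fun x => η (x - k))
      (by apply Continuous.aestronglyMeasurable; fun_prop) (ae_of_all _ fun x => hM _)
    refine this.congr (ae_of_all _ fun x => ?_)
    simp only [mul_comm]
  have e : ∫ y, z y * (η (y + k - x) - η (y - x)) = (∫ y, z y * η (y - (x - k))) - ∫ y, z y * η (y - x) := by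
    rw [← integral_sub (hb _) (hb _)]; congr 1; ext y
    rw [show y + k - x = y - (x - k) by abel]; ring
  rw [e]
  linarith [hmin (x - k)]

lemma concave_aux {θ τ h : ℝ} (hθ0 : 0 < θ) (hθ1 : θ < 1) (hτ : 0 ≤ τ) (hh : 0 < h) :
    τ ^ θ ≤ h ^ θ + θ * h ^ (θ - 1) * (τ - h) := by
  have h1 := rpow_one_add_le_one_add_mul_self (s := τ / h - 1) (p := θ)
    (by have := div_nonneg hτ hh.le; linarith) hθ0.le hθ1.le
  rw [add_sub_cancel, Real.div_rpow hτ hh.le, div_le_iff₀ (by positivity)] at h1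
  refine h1.trans (le_of_eq ?_)
  rw [Real.rpow_sub_one hh.ne']
  field_simp

lemma hB_ge_one {N : ℕ} {α : ℝ} (hα2 : α < 2) {x : EN N} (hx : ‖x‖ < 1) : 1 ≤ hB N α x := by
  unfold hB
  rw [if_pos hx]
  exact Real.one_le_rpow_of_pos_of_le_one_of_nonpos (by nlinarith [norm_nonneg x])
    (by nlinarith [norm_nonneg x]) (by linarith)

lemma hB_out {N : ℕ} {α : ℝ} {x : EN N} (hx : ¬ ‖x‖ < 1) : hB N α x = 0 := by
  unfold hB; rw [if_neg hx]

/-- the subsolution -/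
def wB (N : ℕ) (α A T : ℝ) (x : EN N) : ℝ :=
  A * hB N α x - A * T ^ (α / 2) * hB N α x ^ (1 - α / 2)

lemma wB_out {N : ℕ} {α A T : ℝ} (hα2 : α < 2) {x : EN N} (hx : ¬ ‖x‖ < 1) : wB N α A T x = 0 := by
  unfold wB; rw [hB_out hx, Real.zero_rpow (by linarith)]; ring

lemma hpow_le {N : ℕ} {α : ℝ} (hα0 : 0 < α) (hα2 : α < 2) (x : EN N) :
    hB N α x ^ (1 - α / 2) ≤ hB N α x := by
  by_cases hx : ‖x‖ < 1
  · exact Real.rpow_le_self_of_one_le (hB_ge_one hα2 hx) (by linarith)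
  · rw [hB_out hx, Real.zero_rpow (by linarith)]

lemma wB_meas (N : ℕ) (α A T : ℝ) : Measurable (wB N α A T) := by
  unfold wB
  have := hB_meas N α
  fun_prop

lemma wB_int {N : ℕ} (hN : 3 ≤ N) {α A T : ℝ} (hα0 : 0 < α) (hα2 : α < 2) :
    Integrable (wB N α A T) := by
  have h1 := hB_int hN hα0 hα2
  have h2 : Integrable (fun x => hB N α x ^ (1 - α / 2)) := by
    refine h1.mono' ((hB_meas N α).pow_const _).aestronglyMeasurable (ae_of_all _ fun x => ?_)
    rw [Real.norm_of_nonneg (Real.rpow_nonneg (hB_nonneg _ _ _) _)]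
    exact hpow_le hα0 hα2 x
  exact (h1.const_mul A).sub (h2.const_mul _)

lemma wB_pos {N : ℕ} {α A T : ℝ} (hα0 : 0 < α) (hα2 : α < 2) (hA : 0 < A) (hT : 0 < T) {x : EN N}
    (hw : 0 < wB N α A T x) : ‖x‖ < 1 ∧ T < hB N α x := by
  have hx : ‖x‖ < 1 := by
    by_contra h; rw [wB_out hα2 h] at hw; exact lt_irrefl _ hw
  refine ⟨hx, ?_⟩
  by_contra h
  push Not at h
  have h1 : 0 < hB N α x := by linarith [hB_ge_one hα2 hx]
  have e : hB N α x = hB N α x ^ (α / 2) * hB N α x ^ (1 - α / 2) := by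
    rw [← Real.rpow_add h1]; simp
  have e2 : hB N α x ^ (α / 2) ≤ T ^ (α / 2) := Real.rpow_le_rpow h1.le h (by linarith)
  have e3 : hB N α x ≤ T ^ (α / 2) * hB N α x ^ (1 - α / 2) := by
    calc _ = _ := e
      _ ≤ _ := by gcongr
  unfold wB at hw
  nlinarith

lemma kap_ge {N : ℕ} (hN : 3 ≤ N) {α : ℝ} (hα0 : 0 < α) (hα2 : α < 2) :
    ∃ c, 0 < c ∧ ∀ x : EN N, ‖x‖ < 1 → ∀ ρ, 0 < ρ → ρ ≤ 1 - ‖x‖ →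
      c * hB N α x ^ (α / (1 - α / 2)) ≤ ∫ k, kern N α ρ k * (if ‖x + k‖ < 1 then 0 else 1) := by
  have : Nonempty (Fin N) := ⟨⟨0, by omega⟩⟩
  set ω := (volume : Measure (EN N)).real (ball 0 1) with hω
  have hω0 : 0 < ω := by
    rw [hω, measureReal_def]
    exact ENNReal.toReal_pos (measure_ball_pos _ _ one_pos).ne' measure_ball_lt_top.ne
  refine ⟨ω * 3 ^ (-((N:ℝ) + α)), by positivity, fun x hx ρ hρ hρ2 => ?_⟩
  set d := 1 - ‖x‖ with hd
  have hd0 : 0 < d := by linarith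
  obtain ⟨e, he, hxe⟩ : ∃ e : EN N, ‖e‖ = 1 ∧ x = ‖x‖ • e := by
    by_cases h : x = 0
    · obtain ⟨e, he⟩ := exists_norm_eq (EN N) (zero_le_one (α := ℝ))
      exact ⟨e, he, by simp [h]⟩
    · have : ‖x‖ ≠ 0 := norm_ne_zero_iff.2 h
      refine ⟨‖x‖⁻¹ • x, ?_, by rw [smul_inv_smul₀ this]⟩
      rw [norm_smul, norm_inv, norm_norm, inv_mul_cancel₀ this]
  have hint : Integrable (fun k => kern N α ρ k * (if ‖x + k‖ < 1 then 0 else 1)) := by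
    refine (kern_int hN hα0 hρ).mono' ?_ (ae_of_all _ fun k => ?_)
    · refine ((kern_meas N α ρ).mul (Measurable.ite ?_ (by fun_prop) (by fun_prop))).aestronglyMeasurable
      exact measurableSet_lt (by fun_prop) measurable_const
    · rw [norm_mul, Real.norm_of_nonneg (kern_nonneg _ _ _ _)]
      refine mul_le_of_le_one_right (kern_nonneg _ _ _ _) ?_
      split_ifs <;> simp
  have hnn : ∀ k, 0 ≤ kern N α ρ k * (if ‖x + k‖ < 1 then 0 else 1) := by
    intro k; refine mul_nonneg (kern_nonneg _ _ _ _) ?_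
    split_ifs <;> simp
  have hS : ∀ k ∈ ball ((2 * d) • e) d, (3 * d) ^ (-((N:ℝ) + α)) ≤
      kern N α ρ k * (if ‖x + k‖ < 1 then 0 else 1) := by
    intro k hk
    rw [mem_ball, dist_eq_norm] at hk
    have n1 : ‖(2 * d) • e‖ = 2 * d := by
      rw [norm_smul, he, mul_one, Real.norm_of_nonneg (by linarith)]
    have n2 : ‖k‖ ≤ 3 * d := by
      have := norm_add_le ((2 * d) • e) (k - (2 * d) • e)
      rw [add_sub_cancel, n1] at this; linarith
    have n3 : d < ‖k‖ := by
      have := norm_sub_le k (k - (2 * d) • e)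
      rw [sub_sub_cancel, n1] at this; linarith
    have n4 : ¬ ‖x + k‖ < 1 := by
      have := norm_sub_le (x + k) (k - (2 * d) • e)
      have e2 : x + k - (k - (2 * d) • e) = (1 + d) • e := by
        calc _ = x + (2 * d) • e := by abel
          _ = ‖x‖ • e + (2 * d) • e := by rw [← hxe]
          _ = _ := by rw [← add_smul]; congr 1; rw [hd]; ring
      rw [e2, norm_smul, he, mul_one, Real.norm_of_nonneg (by linarith)] at this
      linarith
    rw [if_neg n4, mul_one]
    unfold kern
    rw [if_pos (by linarith)]
    exact Real.rpow_le_rpow_of_nonpos (by linarith) n2 (by linarith [(Nat.cast_nonneg N : (0:ℝ) ≤ N)])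
  have h1 : (volume : Measure (EN N)).real (ball ((2 * d) • e) d) * (3 * d) ^ (-((N:ℝ) + α)) ≤
      ∫ k, kern N α ρ k * (if ‖x + k‖ < 1 then 0 else 1) := by
    calc _ = ∫ k in ball ((2 * d) • e) d, (3 * d) ^ (-((N:ℝ) + α)) := by
          rw [setIntegral_const, smul_eq_mul]
      _ ≤ ∫ k in ball ((2 * d) • e) d, kern N α ρ k * (if ‖x + k‖ < 1 then 0 else 1) :=
          setIntegral_mono_on (integrableOn_const measure_ball_lt_top.ne) hint.integrableOn
            measurableSet_ball hS
      _ ≤ _ := setIntegral_le_integral hint (ae_of_all _ hnn)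
  have h2 : (volume : Measure (EN N)).real (ball ((2 * d) • e) d) = d ^ N * ω := by
    rw [measureReal_def, Measure.addHaar_ball_of_pos _ _ hd0, ENNReal.toReal_mul,
      ENNReal.toReal_ofReal (by positivity), hω, measureReal_def]
    simp
  have h3 : hB N α x ^ (α / (1 - α / 2)) ≤ d ^ (-α) := by
    have h0 : 0 < 1 - ‖x‖ ^ 2 := by nlinarith [norm_nonneg x]
    unfold hB
    rw [if_pos hx, ← Real.rpow_mul h0.le]
    have : (α / 2 - 1) * (α / (1 - α / 2)) = -α := by
      have : 1 - α / 2 ≠ 0 := by linarith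
      have : 2 - α ≠ 0 := by linarith
      field_simp; ring
    rw [this]
    exact Real.rpow_le_rpow_of_nonpos hd0 (by nlinarith [norm_nonneg x]) (by linarith)
  refine le_trans ?_ h1
  rw [h2, Real.mul_rpow (by norm_num) hd0.le]
  have h4 : d ^ N * d ^ (-((N:ℝ) + α)) = d ^ (-α) := by
    rw [← Real.rpow_natCast, ← Real.rpow_add hd0]; congr 1; ring
  calc _ ≤ ω * 3 ^ (-((N:ℝ) + α)) * d ^ (-α) := by gcongr
    _ = _ := by rw [← h4]; ring

lemma coeff_pos {N : ℕ} (hN : 3 ≤ N) {α : ℝ} (hα0 : 0 < α) (hα2 : α < 2) : 0 < fracLapCoeff N α := by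
  unfold fracLapCoeff
  have h1 : 0 < Real.Gamma (((N : ℝ) + α) / 2) := Real.Gamma_pos_of_pos (by positivity)
  have h2 : Real.Gamma (-α / 2) ≠ 0 := by
    apply Real.Gamma_ne_zero
    intro m hm
    have : α = 2 * m := by linarith
    rcases Nat.eq_zero_or_pos m with h | h
    · subst h; simp at this; linarith
    · have : (1:ℝ) ≤ m := by exact_mod_cast h
      linarith
  have := Real.pi_pos
  positivity

lemma wB_diff {N : ℕ} {α A T : ℝ} (hα0 : 0 < α) (hα2 : α < 2) (hA : 0 < A) (hT : 0 < T)
    {x : EN N} (hx : ‖x‖ < 1) (y : EN N) :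
    A * (1 - (1 - α / 2) * T ^ (α / 2) * hB N α x ^ (-(α / 2))) * (hB N α y - hB N α x) +
      A * T ^ (α / 2) * (α / 2) * hB N α x ^ (1 - α / 2) * (if ‖y‖ < 1 then 0 else 1)
      ≤ wB N α A T y - wB N α A T x := by
  have h1 : 0 < hB N α x := by linarith [hB_ge_one hα2 hx]
  have e : hB N α x ^ (1 - α / 2) = hB N α x ^ (-(α / 2)) * hB N α x := by
    rw [← Real.rpow_add_one h1.ne']; congr 1; ring
  have hpos : 0 ≤ A * T ^ (α / 2) := by positivity
  by_cases hy : ‖y‖ < 1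
  · have := concave_aux (θ := 1 - α / 2) (by linarith) (by linarith) (hB_nonneg N α y) h1
    rw [show 1 - α / 2 - 1 = -(α / 2) by ring] at this
    have := mul_le_mul_of_nonneg_left this hpos
    rw [if_pos hy]
    unfold wB
    linarith
  · rw [if_neg hy, wB_out hα2 hy, hB_out hy]
    unfold wB
    rw [e]
    apply le_of_eq; ring

lemma trunc_w_ge {N : ℕ} (hN : 3 ≤ N) {α A T : ℝ} (hα0 : 0 < α) (hα2 : α < 2) (hA : 0 < A) (hT : 0 < T)
    {x : EN N} (hx : ‖x‖ < 1) {ρ : ℝ} (hρ : 0 < ρ) :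
    A * (1 - (1 - α / 2) * T ^ (α / 2) * hB N α x ^ (-(α / 2))) * trunc N α ρ (hB N α) x +
      A * T ^ (α / 2) * (α / 2) * hB N α x ^ (1 - α / 2) *
        ∫ k, kern N α ρ k * (if ‖x + k‖ < 1 then 0 else 1)
      ≤ trunc N α ρ (wB N α A T) x := by
  have hint : Integrable (fun k => kern N α ρ k * (if ‖x + k‖ < 1 then 0 else 1)) := by
    refine (kern_int hN hα0 hρ).mono' ?_ (ae_of_all _ fun k => ?_)
    · refine ((kern_meas N α ρ).mul (Measurable.ite ?_ (by fun_prop) (by fun_prop))).aestronglyMeasurable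
      exact measurableSet_lt (by fun_prop) measurable_const
    · rw [norm_mul, Real.norm_of_nonneg (kern_nonneg _ _ _ _)]
      refine mul_le_of_le_one_right (kern_nonneg _ _ _ _) ?_
      split_ifs <;> simp
  have hi1 := trunc_integrable hN hα0 hρ (hB_int hN hα0 hα2) x (hB N α x)
  have hi2 := trunc_integrable hN hα0 hρ (wB_int (A := A) (T := T) hN hα0 hα2) x (wB N α A T x)
  unfold trunc
  rw [← integral_const_mul, ← integral_const_mul,
    ← integral_add (hi1.const_mul _) (hint.const_mul _)]
  refine integral_mono ((hi1.const_mul _).add (hint.const_mul _)) hi2 fun k => ?_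
  have := mul_le_mul_of_nonneg_left (wB_diff hα0 hα2 hA hT hx (x + k)) (kern_nonneg N α ρ k)
  simp only
  linarith

lemma subsol {N : ℕ} (hN : 3 ≤ N) {α : ℝ} (hα0 : 0 < α) (hα2 : α < 2) :
    ∃ K, 0 < K ∧ ∀ A T γ γ' : ℝ, 1 ≤ A → 1 ≤ T → 0 < γ → γ ≤ γ' → γ' ≤ 1 + α / 2 →
      A ^ (γ' - 1) ≤ K * T ^ (1 + α / (1 - α / 2) - γ') →
      ∀ r, 0 ≤ r → r < 1 → ∃ C, 0 ≤ C ∧ ∃ ρ₀, 0 < ρ₀ ∧ ∀ x : EN N, ‖x‖ ≤ r → 0 < wB N α A T x →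
        ∀ ρ, 0 < ρ → ρ ≤ ρ₀ →
          wB N α A T x ^ γ - C * ρ ^ (2 - α) ≤ fracLapCoeff N α * trunc N α ρ (wB N α A T) x := by
  obtain ⟨c, hc, Hc⟩ := kap_ge hN hα0 hα2
  have hco := coeff_pos hN hα0 hα2
  refine ⟨fracLapCoeff N α * (α / 2) * c, by positivity, ?_⟩
  intro A T γ γ' hA hT hγ hγγ hγ' hAT r hr0 hr1
  obtain ⟨C, hC, HC⟩ := trunc_h_ge hN hα0 hα2 hr0 hr1
  have hA0 : 0 < A := by linarith
  have hT0 : 0 < T := by linarith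
  refine ⟨fracLapCoeff N α * (A * C), by positivity, min ((1 - r) ^ 2 / 4) (1 - r),
    lt_min (by have : 0 < 1 - r := by linarith
               positivity) (by linarith), ?_⟩
  intro x hx hw ρ hρ hρ0
  obtain ⟨hx1, hTh⟩ := wB_pos hα0 hα2 hA0 hT0 hw
  set h := hB N α x with hh
  have h0 : 0 < h := by linarith
  have h1 : 1 ≤ h := by linarith
  have t1 := HC x hx ρ hρ (hρ0.trans (min_le_left _ _))
  have t2 := Hc x hx1 ρ hρ ((hρ0.trans (min_le_right _ _)).trans (by linarith))
  have t3 := trunc_w_ge hN hα0 hα2 hA0 hT0 hx1 hρ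
  rw [← hh] at t2 t3
  set I := ∫ k, kern N α ρ k * (if ‖x + k‖ < 1 then 0 else 1) with hI
  -- coefficient
  have q1 : T ^ (α / 2) * h ^ (-(α / 2)) ≤ 1 := by
    rw [Real.rpow_neg h0.le, ← div_eq_mul_inv, div_le_one (by positivity)]
    exact Real.rpow_le_rpow hT0.le hTh.le (by linarith)
  have q0 : 0 ≤ T ^ (α / 2) * h ^ (-(α / 2)) := by positivity
  set D := A * (1 - (1 - α / 2) * T ^ (α / 2) * h ^ (-(α / 2))) with hD
  have hD0 : 0 ≤ D := by
    apply mul_nonneg hA0.le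
    rw [mul_assoc]; nlinarith
  have hDA : D ≤ A := by
    have : 0 ≤ A * ((1 - α / 2) * (T ^ (α / 2) * h ^ (-(α / 2)))) := by
      have : 0 ≤ 1 - α / 2 := by linarith
      positivity
    rw [hD]; linarith
  have s1 : -(A * C * ρ ^ (2 - α)) ≤ D * trunc N α ρ (hB N α) x := by
    have p1 := mul_le_mul_of_nonneg_left t1 hD0
    have p2 : D * (C * ρ ^ (2 - α)) ≤ A * (C * ρ ^ (2 - α)) := by gcongr
    linarith
  have s2 : A * T ^ (α / 2) * (α / 2) * h ^ (1 - α / 2) * (c * h ^ (α / (1 - α / 2))) ≤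
     A * T ^ (α / 2) * (α / 2) * h ^ (1 - α / 2) * I := by gcongr
  have s3 : (A * h) ^ γ' ≤ fracLapCoeff N α *
      (A * T ^ (α / 2) * (α / 2) * h ^ (1 - α / 2) * (c * h ^ (α / (1 - α / 2)))) := by
    have hσ : α ≤ α / (1 - α / 2) := by
      rw [le_div_iff₀ (by linarith)]; nlinarith
    set σ := α / (1 - α / 2) with hσd
    have r1 : h ^ γ' * T ^ (1 - α / 2 + σ - γ') ≤ h ^ (1 - α / 2) * h ^ σ := by
      calc _ ≤ h ^ γ' * h ^ (1 - α / 2 + σ - γ') := by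
            have := Real.rpow_le_rpow hT0.le hTh.le (show 0 ≤ 1 - α / 2 + σ - γ' by linarith)
            gcongr
        _ = _ := by
            rw [← Real.rpow_add h0, ← Real.rpow_add h0]; congr 1; ring
    have r2 : A ^ γ' = A * A ^ (γ' - 1) := by
      rw [mul_comm, ← Real.rpow_add_one hA0.ne']; congr 1; ring
    have r3 : T ^ (1 + σ - γ') = T ^ (α / 2) * T ^ (1 - α / 2 + σ - γ') := by
      rw [← Real.rpow_add hT0]; congr 1; ring
    rw [Real.mul_rpow hA0.le h0.le, r2]
    rw [r3] at hAT
    calc A * A ^ (γ' - 1) * h ^ γ' ≤ A * (fracLapCoeff N α * (α / 2) * c *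
          (T ^ (α / 2) * T ^ (1 - α / 2 + σ - γ'))) * h ^ γ' := by gcongr
      _ = A * (fracLapCoeff N α * (α / 2) * c * T ^ (α / 2)) *
            (h ^ γ' * T ^ (1 - α / 2 + σ - γ')) := by ring
      _ ≤ A * (fracLapCoeff N α * (α / 2) * c * T ^ (α / 2)) * (h ^ (1 - α / 2) * h ^ σ) := by gcongr
      _ = _ := by ring
  have s4 : wB N α A T x ^ γ ≤ (A * h) ^ γ' := by
    have : wB N α A T x ≤ A * h := by
      unfold wB
      have : 0 ≤ A * T ^ (α / 2) * hB N α x ^ (1 - α / 2) := by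
        have := hB_nonneg N α x
        positivity
      rw [← hh] at this ⊢
      linarith
    calc _ ≤ (A * h) ^ γ := Real.rpow_le_rpow hw.le this hγ.le
      _ ≤ _ := Real.rpow_le_rpow_of_exponent_le (by nlinarith) hγγ
  have s5 := mul_le_mul_of_nonneg_left (s2.trans (le_sub_iff_add_le'.2 t3)) hco.le
  have s6 := mul_le_mul_of_nonneg_left s1 hco.le
  rw [mul_sub] at s5
  linarith

lemma bump_min {N : ℕ} (hN : 3 ≤ N) {z : EN N → ℝ} (hz : Integrable z)
    (hout : ∀ x, ¬ ‖x‖ < 1 → z x = 0) (hcont : Continuous (fun x => min (z x) 0))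
    {x0 : EN N} (hx0 : z x0 < 0) :
    ∃ φ : EN N → ℝ, ContDiff ℝ (⊤ : ℕ∞) φ ∧ HasCompactSupport φ ∧ (∀ x, 0 ≤ φ x) ∧ ∫ x, φ x = 1 ∧
      (∀ x ∈ tsupport φ, z x < 0) ∧
      ∀ α ρ, 0 < α → 0 < ρ → 0 ≤ ∫ x, z x * trunc N α ρ φ x := by
  have hcs : HasCompactSupport (fun x => min (z x) 0) := by
    refine HasCompactSupport.intro (isCompact_closedBall (0 : EN N) 1) fun x hx => ?_
    rw [hout x (by simp at hx; linarith)]; simp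
  have huc := hcs.uniformContinuous_of_continuous hcont
  set m := -z x0 with hm
  have hm0 : 0 < m := by linarith
  obtain ⟨ε', hε', hU⟩ := Metric.uniformContinuous_iff.1 huc (m / 4) (by linarith)
  set ε := min (ε' / 3) (1 / 2) with hε
  have hε0 : 0 < ε := lt_min (by linarith) (by norm_num)
  have hε1 : ε ≤ 1 / 2 := min_le_right _ _
  have hε3 : 3 * ε ≤ ε' := by have : ε ≤ ε' / 3 := min_le_left _ _; linarith
  let f : ContDiffBump (0 : EN N) := ⟨ε / 2, ε, by linarith, by linarith⟩
  set η : EN N → ℝ := f.normed volume with hη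
  have hηc : ContDiff ℝ (⊤ : ℕ∞) η := f.contDiff_normed
  have hηs : HasCompactSupport η := f.hasCompactSupport_normed
  have hη0 : ∀ x, 0 ≤ η x := f.nonneg_normed
  have hη1 : ∫ x, η x = 1 := f.integral_normed
  have hηz : ∀ x, ε ≤ ‖x‖ → η x = 0 := by
    intro x hx
    have h := f.support_normed_eq (μ := volume)
    by_contra hne
    have h2 : x ∈ Function.support (f.normed volume) := hne
    rw [h] at h2
    simp only [mem_ball, dist_zero_right] at h2
    have : f.rOut = ε := rfl
    linarith
  obtain ⟨M, hM⟩ := hηs.exists_bound_of_continuous hηc.continuous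
  have hηcont := hηc.continuous
  have hηi : Integrable η := hηcont.integrable_of_hasCompactSupport hηs
  have hηx : ∀ x, Integrable (fun y => η (y - x)) := fun x => hηi.comp_sub_right x
  have hηx1 : ∀ x, ∫ y, η (y - x) = 1 := fun x => by rw [integral_sub_right_eq_self η x, hη1]
  have hb : ∀ k, Integrable (fun y => z y * η (y - k)) := by
    intro k
    have := hz.bdd_mul (c := M) (f := fun x => η (x - k))
      (by apply Continuous.aestronglyMeasurable; fun_prop) (ae_of_all _ fun x => hM _)
    refine this.congr (ae_of_all _ fun x => ?_)
    simp only [mul_comm]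
  set Z : EN N → ℝ := fun x => ∫ y, z y * η (y - x) with hZ
  have hZc : Continuous Z := by
    refine continuous_of_dominated (bound := fun y => M * ‖z y‖) (fun x => (hb x).aestronglyMeasurable)
      (fun x => ae_of_all _ fun y => ?_) (hz.norm.const_mul M) (ae_of_all _ fun y => by fun_prop)
    rw [norm_mul, mul_comm]
    gcongr
    exact hM _
  have hZ0 : Z x0 ≤ -(3 * m / 4) := by
    have : Z x0 ≤ ∫ y, -(3 * m / 4) * η (y - x0) := by
      refine integral_mono (hb x0) ((hηx x0).const_mul _) fun y => ?_
      by_cases hy : ε ≤ ‖y - x0‖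
      · simp [hηz _ hy]
      · push Not at hy
        have h1 := hU (a := y) (b := x0) (by rw [dist_eq_norm]; linarith)
        have e : min (z x0) 0 = -m := by rw [min_eq_left hx0.le, hm]; ring
        rw [e, Real.dist_eq, abs_lt] at h1
        have h2 : z y < -(3 * m / 4) := by
          rcases min_cases (z y) 0 with h | h <;> linarith
        exact mul_le_mul_of_nonneg_right h2.le (hη0 _)
    rw [integral_const_mul, hηx1, mul_one] at this
    exact this
  have hZout : ∀ x, 2 ≤ ‖x‖ → Z x = 0 := by
    intro x hx
    have : ∀ y, z y * η (y - x) = 0 := by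
      intro y
      by_cases hy : ε ≤ ‖y - x‖
      · simp [hηz _ hy]
      · rw [hout y, zero_mul]
        intro h
        have := norm_sub_le y (y - x)
        rw [sub_sub_cancel] at this
        linarith
    simp only [hZ, this, integral_zero]
  have hx0n : ‖x0‖ < 1 := by
    by_contra h; rw [hout x0 h] at hx0; exact lt_irrefl _ hx0
  obtain ⟨x1, -, hx1⟩ := (isCompact_closedBall (0 : EN N) 2).exists_isMinOn
    ⟨x0, by simp; linarith⟩ hZc.continuousOn
  have hmin : ∀ x, Z x1 ≤ Z x := by
    intro x
    by_cases h : ‖x‖ ≤ 2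
    · exact hx1 (by simpa using h)
    · rw [hZout x (by linarith)]
      have : Z x1 ≤ Z x0 := hx1 (by simp; linarith)
      linarith
  obtain ⟨y', hy', hzy'⟩ : ∃ y', ‖y' - x1‖ < ε ∧ min (z y') 0 < -(m / 2) := by
    by_contra hcon
    push Not at hcon
    have : ∫ y, -(m / 2) * η (y - x1) ≤ Z x1 := by
      refine integral_mono ((hηx x1).const_mul _) (hb x1) fun y => ?_
      by_cases hy : ε ≤ ‖y - x1‖
      · simp [hηz _ hy]
      · push Not at hy
        exact mul_le_mul_of_nonneg_right ((hcon y hy).trans (min_le_left _ _)) (hη0 _)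
    rw [integral_const_mul, hηx1, mul_one] at this
    linarith [hmin x0]
  refine ⟨fun y => η (y - x1), hηc.comp (contDiff_id.sub contDiff_const),
    hηs.comp_homeomorph (Homeomorph.subRight x1), fun x => hη0 _, hηx1 x1, ?_, ?_⟩
  · intro x hx
    have hsub : tsupport (fun y => η (y - x1)) ⊆ closedBall x1 ε := by
      refine closure_minimal (fun y hy => ?_) isClosed_closedBall
      rw [mem_closedBall, dist_eq_norm]
      by_contra h
      exact hy (hηz _ (by linarith))
    have h1 := hsub hx
    rw [mem_closedBall, dist_eq_norm] at h1
    have h2 : dist x y' < ε' := by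
      rw [dist_eq_norm]
      have := norm_sub_le (x - x1) (y' - x1)
      rw [sub_sub_sub_cancel_right] at this
      linarith
    have h3 := hU h2
    rw [Real.dist_eq, abs_lt] at h3
    rcases min_cases (z x) 0 with h | h <;> linarith
  · intro α ρ hα hρ
    exact swap3 hN hα hρ hz hηcont hηs x1 hmin

lemma u_int {N : ℕ} {α : ℝ} (hα0 : 0 < α) {u : EN N → ℝ}
    (h : memLalpha N α u) (hout : ∀ x, ¬ ‖x‖ < 1 → u x = 0) : Integrable u := by
  unfold memLalpha at h
  have e : ∀ y : EN N, (u y * (1 + ‖y‖) ^ (-((N : ℝ) + α))) * (1 + ‖y‖) ^ ((N : ℝ) + α) = u y := by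
    intro y
    have : 0 < 1 + ‖y‖ := by positivity
    rw [mul_assoc, ← Real.rpow_add this]; simp
  refine (h.norm.mul_const (2 ^ ((N : ℝ) + α))).mono' ?_ (ae_of_all _ fun y => ?_)
  · have hm : Measurable (fun y : EN N => (1 + ‖y‖) ^ ((N : ℝ) + α)) := by fun_prop
    have := h.aestronglyMeasurable.mul hm.aestronglyMeasurable
    refine this.congr (ae_of_all _ fun y => ?_)
    exact e y
  · by_cases hy : ‖y‖ < 1
    · conv_lhs => rw [← e y]
      rw [norm_mul]
      have : 0 < 1 + ‖y‖ := by positivity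
      rw [Real.norm_of_nonneg (Real.rpow_nonneg this.le _)]
      gcongr
      linarith
    · rw [hout y hy, norm_zero]; positivity

lemma wB_cont {N : ℕ} {α A T : ℝ} (hα2 : α < 2) : ContinuousOn (wB N α A T) (ball 0 1) := by
  have h : ContinuousOn (hB N α) (ball 0 1) := by
    have : ContinuousOn (fun x : EN N => (1 - ‖x‖ ^ 2) ^ (α / 2 - 1)) (ball 0 1) := by
      refine ContinuousOn.rpow_const (by fun_prop) fun x hx => Or.inl ?_
      rw [mem_ball_zero_iff] at hx
      have : 0 < 1 - ‖x‖ ^ 2 := by nlinarith [norm_nonneg x]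
      exact this.ne'
    refine this.congr fun x hx => ?_
    unfold hB; rw [if_pos (mem_ball_zero_iff.1 hx)]
  unfold wB
  refine (h.const_smul A).sub (ContinuousOn.const_smul ?_ (A * T ^ (α / 2)))
  exact h.rpow_const fun x hx => Or.inr (by linarith)

lemma wB_le {N : ℕ} {α A T : ℝ} (hA : 0 < A) (hT : 0 < T) (x : EN N) : wB N α A T x ≤ A * hB N α x := by
  unfold wB
  have : 0 ≤ A * T ^ (α / 2) * hB N α x ^ (1 - α / 2) := by
    have := hB_nonneg N α x
    positivity
  linarith

lemma z_ev {N : ℕ} {α γ A T : ℝ} (hα2 : α < 2) (hA : 0 < A) (hT : 0 < T) {u : EN N → ℝ}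
    (hu : IsSolutionPinf N α γ u) {p : EN N} (hp : 1 ≤ ‖p‖) :
    ∀ᶠ x in 𝓝 p, 0 ≤ u x - wB N α A T x := by
  obtain ⟨hnn, -, hout, -, hb⟩ := hu
  have ho : ∀ x, ¬ ‖x‖ < 1 → 0 ≤ u x - wB N α A T x := by
    intro x hx; rw [hout x hx, wB_out hα2 hx]; simp
  rcases hp.lt_or_eq with h | h
  · have : {x : EN N | 1 < ‖x‖} ∈ 𝓝 p := (isOpen_lt continuous_const continuous_norm).mem_nhds h
    filter_upwards [this] with x hx
    exact ho x (not_lt.2 (le_of_lt hx))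
  · have h1 := (hb ⟨p, by simp [← h]⟩).eventually_ge_atTop A
    rw [eventually_nhdsWithin_iff] at h1
    filter_upwards [h1] with x hx
    by_cases hx1 : ‖x‖ < 1
    · have h2 := hx (by simpa using hx1)
      unfold delta1 at h2
      rw [if_pos hx1] at h2
      have hd : 0 < 1 - ‖x‖ := by linarith
      have h3 : hB N α x ≤ (1 - ‖x‖) ^ (α / 2 - 1) := by
        unfold hB
        rw [if_pos hx1]
        exact Real.rpow_le_rpow_of_nonpos hd (by nlinarith [norm_nonneg x]) (by linarith)
      have h4 : (1 - ‖x‖) ^ (α / 2 - 1) * (1 - ‖x‖) ^ (1 - α / 2) = 1 := by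
        rw [← Real.rpow_add hd]; simp
      have h5 : A * (1 - ‖x‖) ^ (α / 2 - 1) ≤ u x := by
        calc _ ≤ ((1 - ‖x‖) ^ (1 - α / 2) * u x) * (1 - ‖x‖) ^ (α / 2 - 1) := by gcongr
          _ = ((1 - ‖x‖) ^ (α / 2 - 1) * (1 - ‖x‖) ^ (1 - α / 2)) * u x := by ring
          _ = u x := by rw [h4, one_mul]
      have h6 := wB_le (α := α) hA hT x
      have h7 := mul_le_mul_of_nonneg_left h3 hA.le
      linarith
    · exact ho x hx1

lemma z_cont {N : ℕ} {α γ A T : ℝ} (hα2 : α < 2) (hA : 0 < A) (hT : 0 < T) {u : EN N → ℝ}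
    (hu : IsSolutionPinf N α γ u) : Continuous (fun x => min (u x - wB N α A T x) 0) := by
  rw [continuous_iff_continuousAt]
  intro p
  by_cases hp : ‖p‖ < 1
  · have hb : ball (0 : EN N) 1 ∈ 𝓝 p := isOpen_ball.mem_nhds (by simpa using hp)
    have h1 : ContinuousAt u p := hu.2.2.2.1.2.1.continuousAt hb
    have h2 : ContinuousAt (wB N α A T) p := (wB_cont hα2).continuousAt hb
    exact (h1.sub h2).min continuousAt_const
  · have := z_ev hα2 hA hT hu (not_lt.1 hp)
    refine (continuousAt_const (y := (0:ℝ))).congr ?_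
    filter_upwards [this] with x hx
    rw [min_eq_right hx]

lemma test_int {N : ℕ} {φ g : EN N → ℝ} (hφ : Continuous φ) (hc : HasCompactSupport φ)
    (hg : ContinuousOn g (tsupport φ)) : Integrable (fun x => g x * φ x) := by
  rw [← integrableOn_iff_integrable_of_support_subset (s := tsupport φ)]
  · exact (hg.mul hφ.continuousOn).integrableOn_compact hc
  · intro x hx
    apply subset_tsupport
    intro h
    exact hx (by simp [h])

lemma phi_trunc_int {N : ℕ} (hN : 3 ≤ N) {α ρ : ℝ} (hα : 0 < α) (hρ : 0 < ρ) {w φ : EN N → ℝ}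
    (hw : Integrable w) (hwm : Measurable w) (hφ : Continuous φ) (hc : HasCompactSupport φ) :
    Integrable (fun x => φ x * trunc N α ρ w x) := by
  obtain ⟨M, hM⟩ := hc.exists_bound_of_continuous hφ
  have hφi : Integrable φ := hφ.integrable_of_hasCompactSupport hc
  have hM0 : 0 ≤ M := (norm_nonneg _).trans (hM 0)
  set k0 := ρ ^ (-((N : ℝ) + α)) with hk0
  set I := ∫ x, ‖w x‖ with hI
  set J := ∫ k, kern N α ρ k with hJ
  have hJ0 : 0 ≤ J := integral_nonneg fun k => kern_nonneg _ _ _ _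
  have hb : ∀ x, |trunc N α ρ w x| ≤ k0 * I + |w x| * J := by
    intro x
    have h1 : ∫ k, (k0 * ‖w (x + k)‖ + |w x| * kern N α ρ k) = k0 * I + |w x| * J := by
      rw [integral_add ((hw.norm.comp_add_left x).const_mul _) ((kern_int hN hα hρ).const_mul _),
        integral_const_mul, integral_const_mul, integral_add_left_eq_self (fun k => ‖w k‖) x]
    rw [← h1, ← Real.norm_eq_abs]
    unfold trunc
    refine norm_integral_le_of_norm_le (((hw.norm.comp_add_left x).const_mul _).add
      ((kern_int hN hα hρ).const_mul _)) (ae_of_all _ fun k => ?_)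
    rw [norm_mul, Real.norm_of_nonneg (kern_nonneg _ _ _ _)]
    have e1 := norm_sub_le (w (x + k)) (w x)
    have e2 := kern_le hα hρ k
    have e3 := kern_nonneg N α ρ k
    calc _ ≤ kern N α ρ k * (‖w (x + k)‖ + ‖w x‖) := by gcongr
      _ = kern N α ρ k * ‖w (x + k)‖ + ‖w x‖ * kern N α ρ k := by ring
      _ ≤ _ := by
        rw [Real.norm_eq_abs (w x)]
        gcongr
  refine ((hφi.norm.mul_const (k0 * I)).add (hw.norm.const_mul (M * J))).mono'
    (hφ.aestronglyMeasurable.mul (trunc_smeas hwm).aestronglyMeasurable) (ae_of_all _ fun x => ?_)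
  rw [norm_mul, Real.norm_eq_abs (trunc N α ρ w x)]
  simp only [Pi.add_apply]
  calc _ ≤ ‖φ x‖ * (k0 * I + |w x| * J) := by gcongr; exact hb x
    _ = ‖φ x‖ * (k0 * I) + ‖φ x‖ * (|w x| * J) := by ring
    _ ≤ ‖φ x‖ * (k0 * I) + M * (|w x| * J) := by gcongr; exact hM x
    _ = _ := by rw [Real.norm_eq_abs (w x)]; ring

lemma u_trunc_int {N : ℕ} (hN : 3 ≤ N) {α ρ : ℝ} (hα0 : 0 < α) (hα2 : α < 2) (hρ : 0 < ρ) {u φ : EN N → ℝ}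
    (hu : Integrable u) (hφ : ContDiff ℝ (⊤ : ℕ∞) φ) (hc : HasCompactSupport φ) :
    Integrable (fun x => u x * trunc N α ρ φ x) := by
  obtain ⟨M, hM, -⟩ := test_bound hN hα0 hα2 hφ hc
  have := hu.bdd_mul (c := M) (f := trunc N α ρ φ)
    (trunc_smeas hφ.continuous.measurable).aestronglyMeasurable (ae_of_all _ fun x => hM ρ hρ x)
  refine this.congr (ae_of_all _ fun x => ?_)
  simp only [mul_comm]

lemma compare {N : ℕ} (hN : 3 ≤ N) {α : ℝ} (hα0 : 0 < α) (hα2 : α < 2) :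
    ∃ K, 0 < K ∧ ∀ A T γ γ' : ℝ, 1 ≤ A → 1 ≤ T → 0 < γ → γ ≤ γ' → γ' ≤ 1 + α / 2 →
      A ^ (γ' - 1) ≤ K * T ^ (1 + α / (1 - α / 2) - γ') →
      ∀ u : EN N → ℝ, IsSolutionPinf N α γ u → ∀ x, wB N α A T x ≤ u x := by
  obtain ⟨K, hK, H⟩ := subsol hN hα0 hα2
  refine ⟨K, hK, ?_⟩
  intro A T γ γ' hA hT hγ hγγ hγ' hAT u hu
  by_contra hcon
  push Not at hcon
  obtain ⟨x0, hx0⟩ := hcon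
  have hA0 : 0 < A := by linarith
  have hT0 : 0 < T := by linarith
  have hui : Integrable u := u_int hα0 hu.2.1 hu.2.2.1
  have hwi : Integrable (wB N α A T) := wB_int hN hα0 hα2
  obtain ⟨φ, hφ, hφc, hφ0, hφ1, hφz, hφt⟩ := bump_min hN (z := fun x => u x - wB N α A T x)
    (hui.sub hwi) (fun x hx => by rw [hu.2.2.1 x hx, wB_out hα2 hx]; simp)
    (z_cont hα2 hA0 hT0 hu) (x0 := x0) (by linarith)
  have hφz : ∀ x ∈ tsupport φ, u x < wB N α A T x := fun x hx => by linarith [hφz x hx]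
  have hwpos : ∀ x ∈ tsupport φ, 0 < wB N α A T x := fun x hx => (hu.1 x).trans_lt (hφz x hx)
  have hsub : tsupport φ ⊆ ball 0 1 := fun x hx => by
    rw [mem_ball_zero_iff]; exact (wB_pos hα0 hα2 hA0 hT0 (hwpos x hx)).1
  have hne : (tsupport φ).Nonempty := by
    by_contra h
    rw [not_nonempty_iff_eq_empty, tsupport_eq_empty_iff] at h
    rw [h] at hφ1; simp at hφ1
  have hcomp : IsCompact (tsupport φ) := hφc
  obtain ⟨xr, hxr, hr⟩ := hcomp.exists_isMaxOn hne continuous_norm.continuousOn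
  obtain ⟨C, hC, ρ₀, hρ₀, HC⟩ := H A T γ γ' hA hT hγ hγγ hγ' hAT ‖xr‖ (norm_nonneg _)
    (by simpa using hsub hxr)
  have cw : ContinuousOn (fun x => wB N α A T x ^ γ) (tsupport φ) :=
    ((wB_cont hα2).mono hsub).rpow_const fun x hx => Or.inr hγ.le
  have cu : ContinuousOn (fun x => u x ^ γ) (tsupport φ) :=
    (hu.2.2.2.1.2.1.mono hsub).rpow_const fun x hx => Or.inr hγ.le
  obtain ⟨xm, hxm, hm⟩ := hcomp.exists_isMinOn hne (cw.sub cu)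
  set m := wB N α A T xm ^ γ - u xm ^ γ with hmd
  have hm0 : 0 < m := by
    have := Real.rpow_lt_rpow (hu.1 xm) (hφz xm hxm) hγ
    linarith
  have iw := test_int hφ.continuous hφc cw
  have iu := test_int hφ.continuous hφc cu
  have iφ : Integrable φ := hφ.continuous.integrable_of_hasCompactSupport hφc
  have hφzero : ∀ x, x ∉ tsupport φ → φ x = 0 := fun x hx => image_eq_zero_of_notMem_tsupport hx
  have step1 : m ≤ (∫ x, wB N α A T x ^ γ * φ x) - ∫ x, u x ^ γ * φ x := by
    rw [← integral_sub iw iu]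
    have : ∫ x, m * φ x ≤ ∫ x, (wB N α A T x ^ γ * φ x - u x ^ γ * φ x) := by
      refine integral_mono (iφ.const_mul m) (iw.sub iu) fun x => ?_
      by_cases hx : x ∈ tsupport φ
      · have h1 : m ≤ wB N α A T x ^ γ - u x ^ γ := hm hx
        have := mul_le_mul_of_nonneg_right h1 (hφ0 x)
        simp only
        linarith
      · simp [hφzero x hx]
    rwa [integral_const_mul, hφ1, mul_one] at this
  have step2 : ∀ ρ, 0 < ρ → ρ ≤ ρ₀ →
      (∫ x, wB N α A T x ^ γ * φ x) - C * ρ ^ (2 - α) ≤ fracLapCoeff N α * ∫ x, u x * trunc N α ρ φ x := by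
    intro ρ hρ hρ0
    have a1 := hφt α ρ hα0 hρ
    have a2 : ∫ x, (u x - wB N α A T x) * trunc N α ρ φ x =
        (∫ x, u x * trunc N α ρ φ x) - ∫ x, φ x * trunc N α ρ (wB N α A T) x := by
      rw [← swap2 hN hα0 hρ hwi hφ.continuous hφc,
        ← integral_sub (u_trunc_int hN hα0 hα2 hρ hui hφ hφc) (u_trunc_int hN hα0 hα2 hρ hwi hφ hφc)]
      congr 1; ext x; ring
    rw [a2] at a1
    have a3 : ∫ x, (wB N α A T x ^ γ * φ x - C * ρ ^ (2 - α) * φ x) ≤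
        ∫ x, fracLapCoeff N α * (φ x * trunc N α ρ (wB N α A T) x) := by
      refine integral_mono (iw.sub (iφ.const_mul _))
        ((phi_trunc_int hN hα0 hρ hwi (wB_meas _ _ _ _) hφ.continuous hφc).const_mul _) fun x => ?_
      by_cases hx : x ∈ tsupport φ
      · have := mul_le_mul_of_nonneg_right (HC x (hr hx) (hwpos x hx) ρ hρ hρ0) (hφ0 x)
        simp only
        linarith
      · simp [hφzero x hx]
    rw [integral_sub iw (iφ.const_mul _), integral_const_mul, integral_const_mul, hφ1, mul_one] at a3
    have := mul_nonneg (coeff_pos hN hα0 hα2).le a1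
    linarith
  have lim1 := dist_tendsto hN hα0 hα2 hφ hφc hui
  rw [hu.2.2.2.1.2.2.2 φ hφ hφc hsub hφ0] at lim1
  have lim2 : Tendsto (fun ρ : ℝ => (∫ x, wB N α A T x ^ γ * φ x) - C * ρ ^ (2 - α)) (𝓝[>] 0)
      (𝓝 ((∫ x, wB N α A T x ^ γ * φ x) - C * 0)) := by
    refine tendsto_const_nhds.sub (Tendsto.const_mul C ?_)
    have := (Real.continuousAt_rpow_const 0 (2 - α) (Or.inr (by linarith))).tendsto
    rw [Real.zero_rpow (by linarith)] at this
    exact this.mono_left nhdsWithin_le_nhds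
  have := le_of_tendsto_of_tendsto lim2 lim1 (by
    have : Iic ρ₀ ∈ 𝓝[>] (0:ℝ) := nhdsWithin_le_nhds (Iic_mem_nhds hρ₀)
    filter_upwards [this, self_mem_nhdsWithin] with ρ h1 h2
    exact step2 ρ h2 h1)
  linarith

lemma shell {N : ℕ} (hN : 3 ≤ N) {α : ℝ} (hα0 : 0 < α) (hα2 : α < 2) :
    ∃ c M, 0 < c ∧ 0 < M ∧ ∀ A T : ℝ, 1 ≤ A → 1 ≤ T → ∀ u : EN N → ℝ, Integrable u → (∀ x, 0 ≤ u x) →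
      (∀ x, wB N α A T x ≤ u x) → c * A * (M * T) ^ (1 - 1 / (1 - α / 2)) ≤ ∫ x, u x := by
  have : Nonempty (Fin N) := ⟨⟨0, by omega⟩⟩
  set ω := (volume : Measure (EN N)).real (ball 0 1) with hω
  have hω0 : 0 < ω := by
    rw [hω, measureReal_def]
    exact ENNReal.toReal_pos (measure_ball_pos _ _ one_pos).ne' measure_ball_lt_top.ne
  refine ⟨ω / 2, 2 ^ (2 / α), by positivity, by positivity, ?_⟩
  intro A T hA hT u hui hu0 huw
  set M : ℝ := 2 ^ (2 / α) with hM
  have hM1 : 1 ≤ M := Real.one_le_rpow (by norm_num) (by positivity)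
  have hM2 : M ^ (α / 2) = 2 := by
    rw [hM, ← Real.rpow_mul (by norm_num), show 2 / α * (α / 2) = 1 by field_simp, Real.rpow_one]
  set R := M * T with hR
  have hR1 : 1 ≤ R := by nlinarith
  have hR0 : 0 < R := by linarith
  have hβ : 0 < 1 - α / 2 := by linarith
  set d := R ^ (-(1 / (1 - α / 2))) with hd
  have hd0 : 0 < d := by positivity
  have hd1 : d ≤ 1 := Real.rpow_le_one_of_one_le_of_nonpos hR1 (by
    have : 0 < 1 / (1 - α / 2) := by positivity
    linarith)
  set r := √(1 - d) with hr
  have hr0 : 0 ≤ r := Real.sqrt_nonneg _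
  have hr2 : r ^ 2 = 1 - d := Real.sq_sqrt (by linarith)
  have hr1 : r ≤ 1 := by nlinarith
  have hvol : ω * d ≤ (volume : Measure (EN N)).real (ball 0 1 \ ball 0 r) := by
    rw [measureReal_sdiff (ball_subset_ball hr1) measurableSet_ball]
    have : (volume : Measure (EN N)).real (ball 0 r) = r ^ N * ω := by
      rw [measureReal_def, Measure.addHaar_ball _ _ hr0, ENNReal.toReal_mul,
        ENNReal.toReal_ofReal (by positivity), hω, measureReal_def]
      simp
    rw [this, ← hω]
    have h2 : r ^ N ≤ r ^ 2 := pow_le_pow_of_le_one hr0 hr1 (by omega)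
    rw [hr2] at h2
    nlinarith
  have hS : ∀ x ∈ ball (0 : EN N) 1 \ ball 0 r, A * R / 2 ≤ u x := by
    intro x hx
    rw [Set.mem_sdiff, mem_ball_zero_iff, mem_ball_zero_iff, not_lt] at hx
    have hx0 : 0 < 1 - ‖x‖ ^ 2 := by nlinarith [norm_nonneg x, hx.1]
    have hxd : 1 - ‖x‖ ^ 2 ≤ d := by
      have := pow_le_pow_left₀ hr0 hx.2 2
      linarith
    have hh : R ≤ hB N α x := by
      unfold hB
      rw [if_pos hx.1]
      calc R = d ^ (α / 2 - 1) := by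
            rw [hd, ← Real.rpow_mul hR0.le]
            rw [show -(1 / (1 - α / 2)) * (α / 2 - 1) = 1 by
              have := hβ.ne'
              rw [show α / 2 - 1 = -(1 - α / 2) by ring, neg_mul_neg, one_div, inv_mul_cancel₀ this],
              Real.rpow_one]
        _ ≤ _ := Real.rpow_le_rpow_of_nonpos hx0 hxd (by linarith)
    set h := hB N α x with hhd
    have h0 : 0 < h := by linarith
    refine le_trans ?_ (huw x)
    unfold wB
    rw [← hhd]
    have e1 : 2 * T ^ (α / 2) ≤ h ^ (α / 2) := by
      have e0 : R ^ (α / 2) = 2 * T ^ (α / 2) := by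
        rw [hR, Real.mul_rpow (by linarith) (by linarith), hM2]
      rw [← e0]
      exact Real.rpow_le_rpow hR0.le hh (by linarith)
    have e2 : h ^ (α / 2) * h ^ (1 - α / 2) = h := by
      rw [← Real.rpow_add h0]; simp
    have e3 : 2 * T ^ (α / 2) * h ^ (1 - α / 2) ≤ h := by
      calc _ ≤ h ^ (α / 2) * h ^ (1 - α / 2) := by gcongr
        _ = h := e2
    nlinarith
  have h1 : (volume : Measure (EN N)).real (ball 0 1 \ ball 0 r) * (A * R / 2) ≤ ∫ x, u x := by
    have hfin : (volume : Measure (EN N)) (ball 0 1 \ ball 0 r) ≠ ⊤ :=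
      ((measure_mono sdiff_subset).trans_lt measure_ball_lt_top).ne
    calc _ = ∫ x in ball (0 : EN N) 1 \ ball 0 r, A * R / 2 := by
          rw [setIntegral_const, smul_eq_mul]
      _ ≤ ∫ x in ball (0 : EN N) 1 \ ball 0 r, u x :=
          setIntegral_mono_on (integrableOn_const hfin) hui.integrableOn
            (measurableSet_ball.diff measurableSet_ball) hS
      _ ≤ _ := setIntegral_le_integral hui (ae_of_all _ hu0)
  refine le_trans ?_ h1
  have : R ^ (1 - 1 / (1 - α / 2)) = d * R := by
    rw [hd, ← Real.rpow_add_one hR0.ne']; congr 1; ring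
  rw [this]
  calc _ = ω * d * (A * R / 2) := by ring
    _ ≤ _ := by gcongr

theorem main_aux {N : ℕ} (hN : 3 ≤ N) {α γ : ℝ} (hα0 : 0 < α) (hα2 : α < 2) (hγ : 0 < γ) (hγ2 : γ < 1 + α / 2)
    {u : EN N → ℝ} (hu : IsSolutionPinf N α γ u) : False := by
  obtain ⟨K, hK, H⟩ := compare hN hα0 hα2
  obtain ⟨c, M, hc, hM, HS⟩ := shell hN hα0 hα2
  have hui : Integrable u := u_int hα0 hu.2.1 hu.2.2.1
  set s := max γ (1 + α / 4) - 1 with hs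
  have hs0 : 0 < s := by have := le_max_right γ (1 + α / 4); linarith
  have hs1 : s < α / 2 := by
    have : max γ (1 + α / 4) < 1 + α / 2 := max_lt hγ2 (by linarith)
    linarith
  have hγs : γ ≤ 1 + s := by have := le_max_left γ (1 + α / 4); linarith
  have hβ : 0 < 1 - α / 2 := by linarith
  set σ := α / (1 - α / 2) with hσ
  have hσα : σ * (1 - α / 2) = α := by rw [hσ]; exact div_mul_cancel₀ _ hβ.ne'
  have hσ0 : 0 < σ := by positivity
  have hσs : s < σ := by nlinarith
  -- exponent
  have hE : 1 - 1 / (1 - α / 2) = -(σ / 2) := by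
    rw [hσ]
    have hb := hβ.ne'
    rw [eq_comm, ← sub_eq_zero]
    have : -(α / (1 - α / 2) / 2) - (1 - 1 / (1 - α / 2)) = (1 - α / 2) / (1 - α / 2) - 1 := by ring
    rw [this, div_self hb, sub_self]
  set e := (σ - s) / s - σ / 2 with he
  have he0 : 0 < e := by
    have : σ / 2 < (σ - s) / s := by
      rw [lt_div_iff₀ hs0]
      have h1 : s * (1 + σ / 2) < α / 2 * (1 + σ / 2) := by
        apply mul_lt_mul_of_pos_right hs1; positivity
      nlinarith
    linarith
  have key : ∀ T : ℝ, 1 ≤ T → 1 ≤ K * T ^ (σ - s) →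
      c * K ^ (1 / s) * M ^ (-(σ / 2)) * T ^ e ≤ ∫ x, u x := by
    intro T hT hKT
    have hT0 : 0 < T := by linarith
    set A := (K * T ^ (σ - s)) ^ (1 / s) with hA
    have hA1 : 1 ≤ A := Real.one_le_rpow hKT (by positivity)
    have hAs : A ^ s = K * T ^ (σ - s) := by
      rw [hA, ← Real.rpow_mul (by positivity), one_div, inv_mul_cancel₀ hs0.ne', Real.rpow_one]
    have h1 := H A T γ (1 + s) hA1 hT hγ hγs (by linarith) (by
      rw [show 1 + s - 1 = s by ring, hAs, show 1 + σ - (1 + s) = σ - s by ring]) u hu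
    have h2 := HS A T hA1 hT u hui hu.1 h1
    refine le_trans (le_of_eq ?_) h2
    rw [hE, Real.mul_rpow hM.le hT0.le, hA, Real.mul_rpow hK.le (by positivity),
      ← Real.rpow_mul hT0.le]
    have : T ^ e = T ^ ((σ - s) * (1 / s)) * T ^ (-(σ / 2)) := by
      rw [← Real.rpow_add hT0]; congr 1; rw [he]; ring
    rw [this]; ring
  have t1 : Tendsto (fun T : ℝ => K * T ^ (σ - s)) atTop atTop :=
    (tendsto_rpow_atTop (by linarith)).const_mul_atTop hK
  have t2 : Tendsto (fun T : ℝ => c * K ^ (1 / s) * M ^ (-(σ / 2)) * T ^ e) atTop atTop :=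
    (tendsto_rpow_atTop he0).const_mul_atTop (by positivity)
  obtain ⟨T, h1, h2, h3⟩ := ((eventually_ge_atTop (1:ℝ)).and ((t1.eventually_ge_atTop 1).and
    (t2.eventually_gt_atTop (∫ x, u x)))).exists
  linarith [key T h1 h2]

/-- nonexistence for `(P_∞)` when `0 < γ < 1 + α/2`. -/
theorem statement_12 (N : ℕ) (hN : 3 ≤ N) (α : ℝ) (hα0 : 0 < α) (hα2 : α < 2)
    (γ : ℝ) (hγ0 : 0 < γ) (hγ1 : γ < 1 + α / 2) :
    ¬ ∃ u : EN N → ℝ, IsSolutionPinf N α γ u := by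
  rintro ⟨u, hu⟩
  exact main_aux hN hα0 hα2 hγ0 hγ1 hu

end
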